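/- arXiv:1610.08897 — 5 statements merged into one kernel-verified Lean document; each statement's English description precedes it below -/
import Mathlib

section
/- Let d ≥ 1, let α, β ∈ ℝ satisfy α + β > d, and set c = 9/64. Let w : ℤ^d × ℤ^d → [0,1] be any function such that w(ω₁, ω₂) = 0 whenever (|ω₁| > 8/3 or |ω₂| > 8/3) and (|ω₁| < c|ω₂| or |ω₁| > c⁻¹|ω₂|). Then there exists a constant C < ∞ (depending only on d, α, β, and not on w) such that for every ω ∈ ℤ^d, ∑_{ω₁ + ω₂ = ω} w(ω₁, ω₂) ⟨ω₁⟩^{-α} ⟨ω₂⟩^{-β} ≤ C ⟨ω⟩^{d - α - β}. -/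
open scoped BigOperators

/-- The Euclidean norm of `ω ∈ ℤ^d`. -/
noncomputable def znorm {d : ℕ} (ω : Fin d → ℤ) : ℝ :=
  Real.sqrt (∑ i, ((ω i : ℝ)) ^ 2)

/-- The Japanese bracket `⟨ω⟩ = (1 + 4π²|ω|²)^{1/2}` of `ω ∈ ℤ^d`. -/
noncomputable def jap {d : ℕ} (ω : Fin d → ℤ) : ℝ :=
  Real.sqrt (1 + 4 * Real.pi ^ 2 * ∑ i, ((ω i : ℝ)) ^ 2)

lemma jap_sq {d : ℕ} (ω : Fin d → ℤ) :
    jap ω ^ 2 = 1 + 4 * Real.pi ^ 2 * ∑ i, ((ω i : ℝ)) ^ 2 :=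
  Real.sq_sqrt (by positivity)

lemma znorm_sq {d : ℕ} (ω : Fin d → ℤ) : znorm ω ^ 2 = ∑ i, ((ω i : ℝ)) ^ 2 :=
  Real.sq_sqrt (by positivity)

lemma znorm_nonneg {d : ℕ} (ω : Fin d → ℤ) : 0 ≤ znorm ω := Real.sqrt_nonneg _

lemma one_le_jap {d : ℕ} (ω : Fin d → ℤ) : 1 ≤ jap ω :=
  Real.one_le_sqrt.2 (le_add_of_nonneg_right (by positivity))

lemma jap_pos {d : ℕ} (ω : Fin d → ℤ) : 0 < jap ω := one_pos.trans_le (one_le_jap ω)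

lemma abs_coord_le_jap {d : ℕ} (ω : Fin d → ℤ) (i : Fin d) : |(ω i : ℝ)| ≤ jap ω := by
  refine abs_le_of_sq_le_sq ?_ (jap_pos ω).le
  have h : ((ω i : ℝ)) ^ 2 ≤ ∑ j, ((ω j : ℝ)) ^ 2 :=
    Finset.single_le_sum (f := fun j => ((ω j : ℝ)) ^ 2) (fun _ _ => sq_nonneg _)
      (Finset.mem_univ i)
  rw [jap_sq]
  have hpi : 1 ≤ 4 * Real.pi ^ 2 := by nlinarith [Real.pi_gt_three]
  linarith [le_mul_of_one_le_left ((sq_nonneg _).trans h) hpi]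

lemma jap_add_sq_le {d : ℕ} (a b : Fin d → ℤ) :
    jap (a + b) ^ 2 ≤ 2 * (jap a ^ 2 + jap b ^ 2) := by
  have h : ∑ i, (((a + b) i : ℤ) : ℝ) ^ 2 ≤
      2 * (∑ i, ((a i : ℝ)) ^ 2 + ∑ i, ((b i : ℝ)) ^ 2) := by
    rw [← Finset.sum_add_distrib, Finset.mul_sum]
    refine Finset.sum_le_sum fun i _ => ?_
    push_cast [Pi.add_apply]
    nlinarith [sq_nonneg ((a i : ℝ) - b i)]
  simp only [jap_sq]
  nlinarith [mul_le_mul_of_nonneg_left h (by positivity : 0 ≤ 4 * Real.pi ^ 2)]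

lemma jap_le_of_znorm_le_const {d : ℕ} {a : Fin d → ℤ} (b : Fin d → ℤ)
    (h : znorm a ≤ 8 / 3) : jap a ≤ 20 * jap b := by
  refine le_trans ?_ (le_mul_of_one_le_right (by norm_num) (one_le_jap b))
  refine (sq_le_sq₀ (jap_pos _).le (by norm_num)).1 ?_
  rw [jap_sq, ← znorm_sq]
  have hz : znorm a ^ 2 ≤ (8 / 3) ^ 2 := pow_le_pow_left₀ (znorm_nonneg a) h 2
  have hpi : Real.pi ^ 2 ≤ 3.15 ^ 2 :=
    pow_le_pow_left₀ Real.pi_pos.le Real.pi_lt_d2.le 2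
  nlinarith [mul_le_mul hpi hz (sq_nonneg _) (by norm_num)]

lemma jap_le_of_znorm_le_mul {d : ℕ} {a b : Fin d → ℤ}
    (h : znorm a ≤ 64 / 9 * znorm b) : jap a ≤ 20 * jap b := by
  refine (sq_le_sq₀ (jap_pos _).le (by have := jap_pos b; positivity)).1 ?_
  rw [mul_pow, jap_sq, jap_sq, ← znorm_sq, ← znorm_sq]
  have hz : znorm a ^ 2 ≤ (64 / 9 * znorm b) ^ 2 := pow_le_pow_left₀ (znorm_nonneg a) h 2
  have hz' : znorm a ^ 2 ≤ 400 * znorm b ^ 2 := by nlinarith [sq_nonneg (znorm b)]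
  nlinarith [mul_le_mul_of_nonneg_left hz' (by positivity : 0 ≤ 4 * Real.pi ^ 2)]

lemma rpow_le_mul_rpow_of_comparable {x y K : ℝ} (hx : 0 < x) (hy : 0 < y) (hK : 0 < K)
    (hxy : x ≤ K * y) (hyx : y ≤ K * x) (b : ℝ) : x ^ b ≤ K ^ |b| * y ^ b := by
  rcases le_total 0 b with hb | hb
  · rw [abs_of_nonneg hb, ← Real.mul_rpow hK.le hy.le]
    exact Real.rpow_le_rpow hx.le hxy hb
  · have h := Real.rpow_le_rpow_of_nonpos hy hyx hb
    rw [Real.mul_rpow hK.le hx.le] at h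
    calc x ^ b = K ^ (-b) * (K ^ b * x ^ b) := by
          rw [← mul_assoc, ← Real.rpow_add hK, neg_add_cancel, Real.rpow_zero, one_mul]
      _ ≤ K ^ |b| * y ^ b := by
          rw [abs_of_nonpos hb]
          exact mul_le_mul_of_nonneg_left h (Real.rpow_nonneg hK.le _)

/-- Lattice points in a ball for the Japanese bracket: there are at most `(3ρ)^d` of them. -/
lemma card_filter_jap_lt_le {d : ℕ} (S : Finset (Fin d → ℤ)) {ρ : ℝ} (hρ : 0 < ρ) :
    ((S.filter fun ω => jap ω < ρ).card : ℝ) ≤ (3 * ρ) ^ d := by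
  rcases lt_or_ge ρ 1 with h1 | h1
  · rw [Finset.filter_false_of_mem fun ω _ => not_lt.2 (h1.le.trans (one_le_jap ω))]
    simp only [Finset.card_empty, Nat.cast_zero]
    positivity
  have hsub : (S.filter fun ω => jap ω < ρ) ⊆
      Fintype.piFinset fun _ : Fin d => Finset.Icc (-⌊ρ⌋) ⌊ρ⌋ := by
    intro ω hω
    rw [Fintype.mem_piFinset]
    intro i
    have h := abs_le.1 ((abs_coord_le_jap ω i).trans (Finset.mem_filter.1 hω).2.le)
    rw [Finset.mem_Icc, neg_le, Int.le_floor, Int.le_floor]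
    push_cast
    exact ⟨by linarith [h.1], h.2⟩
  have hfl : (0 : ℤ) ≤ ⌊ρ⌋ := Int.floor_nonneg.2 hρ.le
  have hcard : ((Finset.Icc (-⌊ρ⌋) ⌊ρ⌋).card : ℝ) ≤ 3 * ρ := by
    have h : ((Finset.Icc (-⌊ρ⌋) ⌊ρ⌋).card : ℤ) = 2 * ⌊ρ⌋ + 1 := by
      rw [Int.card_Icc]; omega
    have h' : ((Finset.Icc (-⌊ρ⌋) ⌊ρ⌋).card : ℝ) = 2 * ⌊ρ⌋ + 1 := by exact_mod_cast h
    rw [h']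
    linarith [Int.floor_le ρ]
  calc ((S.filter fun ω => jap ω < ρ).card : ℝ)
      ≤ ((Fintype.piFinset fun _ : Fin d => Finset.Icc (-⌊ρ⌋) ⌊ρ⌋).card : ℝ) := by
        exact_mod_cast Finset.card_le_card hsub
    _ = ((Finset.Icc (-⌊ρ⌋) ⌊ρ⌋).card : ℝ) ^ d := by simp [Fintype.card_piFinset]
    _ ≤ (3 * ρ) ^ d := pow_le_pow_left₀ (Nat.cast_nonneg _) hcard d

/-- Tail sums of `⟨ω⟩^{-s}` for `s > d`, by dyadic decomposition. -/
lemma sum_jap_rpow_tail_le {d : ℕ} {s : ℝ} (hs : (d : ℝ) < s) {R : ℝ} (hR : 0 < R)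
    (S : Finset (Fin d → ℤ)) (hS : ∀ ω ∈ S, R ≤ jap ω) :
    ∑ ω ∈ S, jap ω ^ (-s) ≤ 6 ^ d * (1 - (2 : ℝ) ^ ((d : ℝ) - s))⁻¹ * R ^ ((d : ℝ) - s) := by
  set q : ℝ := (2 : ℝ) ^ ((d : ℝ) - s) with hq
  have hq0 : 0 ≤ q := by positivity
  have hq1 : q < 1 := Real.rpow_lt_one_of_one_lt_of_neg one_lt_two (by linarith)
  have hs0 : 0 ≤ s := (Nat.cast_nonneg d).trans hs.le
  choose! k hk using fun ω (hω : ω ∈ S) =>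
    exists_nat_pow_near ((one_le_div hR).2 (hS ω hω)) (one_lt_two (α := ℝ))
  obtain ⟨N, hN⟩ : ∃ N, ∀ ω ∈ S, k ω < N :=
    ⟨S.sup k + 1, fun ω hω => Nat.lt_succ_of_le (Finset.le_sup hω)⟩
  have hpow (n : ℕ) : 0 < (2 : ℝ) ^ n * R := by positivity
  calc ∑ ω ∈ S, jap ω ^ (-s)
      = ∑ n ∈ Finset.range N, ∑ ω ∈ S with k ω = n, jap ω ^ (-s) :=
        (Finset.sum_fiberwise_of_maps_to (fun ω hω => Finset.mem_range.2 (hN ω hω)) _).symm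
    _ ≤ ∑ n ∈ Finset.range N, 6 ^ d * R ^ ((d : ℝ) - s) * q ^ n := by
        refine Finset.sum_le_sum fun n _ => ?_
        have hterm : ∀ ω ∈ S.filter (fun ω => k ω = n), jap ω ^ (-s) ≤ (2 ^ n * R) ^ (-s) := by
          intro ω hω
          obtain ⟨hωS, rfl⟩ := Finset.mem_filter.1 hω
          exact Real.rpow_le_rpow_of_nonpos (hpow _) ((le_div_iff₀ hR).1 (hk ω hωS).1)
            (neg_nonpos.2 hs0)
        have hsub : S.filter (fun ω => k ω = n) ⊆ S.filter fun ω => jap ω < 2 ^ (n + 1) * R := by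
          intro ω hω
          obtain ⟨hωS, rfl⟩ := Finset.mem_filter.1 hω
          exact Finset.mem_filter.2 ⟨hωS, (div_lt_iff₀ hR).1 (hk ω hωS).2⟩
        have hcard : ((S.filter fun ω => k ω = n).card : ℝ) ≤ (3 * (2 ^ (n + 1) * R)) ^ d :=
          le_trans (by exact_mod_cast Finset.card_le_card hsub)
            (card_filter_jap_lt_le S (hpow _))
        have hqn : q ^ n = ((2 : ℝ) ^ n) ^ ((d : ℝ) - s) := by
          rw [hq, ← Real.rpow_mul_natCast two_pos.le, mul_comm, Real.rpow_mul two_pos.le,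
            Real.rpow_natCast]
        calc ∑ ω ∈ S with k ω = n, jap ω ^ (-s)
            ≤ (S.filter fun ω => k ω = n).card * (2 ^ n * R) ^ (-s) := by
              simpa only [nsmul_eq_mul] using Finset.sum_le_card_nsmul _ _ _ hterm
          _ ≤ (3 * (2 ^ (n + 1) * R)) ^ d * (2 ^ n * R) ^ (-s) :=
              mul_le_mul_of_nonneg_right hcard (Real.rpow_nonneg (hpow n).le _)
          _ = 6 ^ d * (2 ^ n * R) ^ ((d : ℝ) - s) := by
              rw [sub_eq_add_neg, Real.rpow_add (hpow n), Real.rpow_natCast,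
                show 3 * (2 ^ (n + 1) * R) = 6 * (2 ^ n * R) by ring, mul_pow 6, mul_assoc]
          _ = 6 ^ d * R ^ ((d : ℝ) - s) * q ^ n := by
              rw [Real.mul_rpow (by positivity) hR.le, hqn]
              ring
    _ = 6 ^ d * R ^ ((d : ℝ) - s) * ∑ n ∈ Finset.range N, q ^ n := (Finset.mul_sum ..).symm
    _ ≤ 6 ^ d * R ^ ((d : ℝ) - s) * (1 - q)⁻¹ := by
        refine mul_le_mul_of_nonneg_left ?_ (by positivity)
        rw [← tsum_geometric_of_lt_one hq0 hq1]
        exact (summable_geometric_of_lt_one hq0 hq1).sum_le_tsum _ fun _ _ => pow_nonneg hq0 _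
    _ = _ := by ring

/-- Bound on resonant discrete convolutions (Lemma on resonant products): the constant is
uniform over all weights `w` with the stated support and boundedness properties. -/
theorem resonant_convolution_bound (d : ℕ) (hd : 1 ≤ d) (α β : ℝ) (hαβ : α + β > d) :
    ∃ C : ℝ, ∀ w : (Fin d → ℤ) → (Fin d → ℤ) → ℝ,
      (∀ ω₁ ω₂, w ω₁ ω₂ ∈ Set.Icc (0 : ℝ) 1) →
      (∀ ω₁ ω₂ : Fin d → ℤ,
        (znorm ω₁ > 8 / 3 ∨ znorm ω₂ > 8 / 3) →
        (znorm ω₁ < (9 / 64 : ℝ) * znorm ω₂ ∨ znorm ω₁ > (9 / 64 : ℝ)⁻¹ * znorm ω₂) →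
        w ω₁ ω₂ = 0) →
      ∀ ω : Fin d → ℤ,
        ∑' ω₁ : Fin d → ℤ, w ω₁ (ω - ω₁) * (jap ω₁ ^ (-α) * jap (ω - ω₁) ^ (-β))
          ≤ C * jap ω ^ ((d : ℝ) - α - β) := by
  set A : ℝ := 6 ^ d * (1 - (2 : ℝ) ^ ((d : ℝ) - (α + β)))⁻¹
  refine ⟨20 ^ |-β| * (A * 30⁻¹ ^ ((d : ℝ) - (α + β))), fun w hw hsupp ω => ?_⟩
  have hcomp : ∀ a b : Fin d → ℤ, w a b ≠ 0 → jap a ≤ 20 * jap b ∧ jap b ≤ 20 * jap a := by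
    intro a b hab
    by_cases hsmall : znorm a > 8 / 3 ∨ znorm b > 8 / 3
    · have h := mt (hsupp a b hsmall) hab
      push Not at h
      exact ⟨jap_le_of_znorm_le_mul (by linarith [h.2]), jap_le_of_znorm_le_mul (by linarith [h.1])⟩
    · push Not at hsmall
      exact ⟨jap_le_of_znorm_le_const b hsmall.1, jap_le_of_znorm_le_const a hsmall.2⟩
  have hnonneg : ∀ a, 0 ≤ w a (ω - a) * (jap a ^ (-α) * jap (ω - a) ^ (-β)) := fun a =>
    mul_nonneg (hw _ _).1 (mul_nonneg (Real.rpow_nonneg (jap_pos _).le _)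
      (Real.rpow_nonneg (jap_pos _).le _))
  have hR : 0 < 30⁻¹ * jap ω := mul_pos (by norm_num) (jap_pos ω)
  refine Real.tsum_le_of_sum_le hnonneg fun S => ?_
  calc ∑ a ∈ S, w a (ω - a) * (jap a ^ (-α) * jap (ω - a) ^ (-β))
      = ∑ a ∈ S with w a (ω - a) ≠ 0, w a (ω - a) * (jap a ^ (-α) * jap (ω - a) ^ (-β)) :=
        (Finset.sum_filter_of_ne fun a _ => left_ne_zero_of_mul).symm
    _ ≤ ∑ a ∈ S with w a (ω - a) ≠ 0, 20 ^ |-β| * jap a ^ (-(α + β)) := by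
        refine Finset.sum_le_sum fun a ha => ?_
        obtain ⟨h₁, h₂⟩ := hcomp _ _ (Finset.mem_filter.1 ha).2
        have hα : 0 ≤ jap a ^ (-α) := Real.rpow_nonneg (jap_pos a).le _
        calc w a (ω - a) * (jap a ^ (-α) * jap (ω - a) ^ (-β))
            ≤ jap a ^ (-α) * jap (ω - a) ^ (-β) :=
              mul_le_of_le_one_left
                (mul_nonneg hα (Real.rpow_nonneg (jap_pos _).le _)) (hw _ _).2
          _ ≤ jap a ^ (-α) * (20 ^ |-β| * jap a ^ (-β)) :=
              mul_le_mul_of_nonneg_left (rpow_le_mul_rpow_of_comparable (jap_pos _) (jap_pos _)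
                (by norm_num) h₂ h₁ _) hα
          _ = 20 ^ |-β| * jap a ^ (-(α + β)) := by
              rw [neg_add, Real.rpow_add (jap_pos a)]
              ring
    _ = 20 ^ |-β| * ∑ a ∈ S with w a (ω - a) ≠ 0, jap a ^ (-(α + β)) :=
        (Finset.mul_sum ..).symm
    _ ≤ 20 ^ |-β| * (A * (30⁻¹ * jap ω) ^ ((d : ℝ) - (α + β))) := by
        refine mul_le_mul_of_nonneg_left (sum_jap_rpow_tail_le hαβ hR _ fun a ha => ?_)
          (by positivity)
        have h₂ := (hcomp _ _ (Finset.mem_filter.1 ha).2).2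
        have h := jap_add_sq_le a (ω - a)
        rw [add_sub_cancel] at h
        have h30 : jap ω ≤ 30 * jap a := by
          refine (sq_le_sq₀ (jap_pos _).le (by have := jap_pos a; positivity)).1 ?_
          nlinarith [pow_le_pow_left₀ (jap_pos _).le h₂ 2, sq_nonneg (jap a)]
        linarith
    _ = _ := by
        rw [Real.mul_rpow (by norm_num) (jap_pos ω).le, sub_sub]
        ring
end

section
/- There exist constants c₁, c₂ > 0 such that for every integer n ≥ 2, c₁ log n ≤ ∑_{ω₁, ω₂ ∈ ℤ³, |ω₁| ≤ n, |ω₂| ≤ n} 1 / ( ⟨ω₁⟩² ⟨ω₂⟩² ( ⟨ω₁⟩² + ⟨ω₂⟩² + ⟨ω₁ + ω₂⟩² ) ) ≤ c₂ log n. In particular this sum, which (up to a factor 1/4) equals the renormalisation constant c_n' for the diagram ⟨22⟩, diverges logarithmically as n → ∞. -/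
open scoped BigOperators

/-- The squared Japanese bracket `⟨ω⟩² = 1 + 4π²|ω|²` of `ω ∈ ℤ³`. -/
noncomputable def japSq (ω : Fin 3 → ℤ) : ℝ :=
  1 + 4 * Real.pi ^ 2 * ∑ i, ((ω i : ℝ)) ^ 2

/-- The sup norm on `ℤ³`, as a natural number. -/
def supNorm (ω : Fin 3 → ℤ) : ℕ := Finset.univ.sup fun i => (ω i).natAbs

/-- The cube of side `2n + 1` centred at the origin of `ℤ³`. -/
noncomputable def cube (n : ℕ) : Finset (Fin 3 → ℤ) :=
  Fintype.piFinset fun _ => Finset.Icc (-(n : ℤ)) n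

lemma supNorm_le_iff {ω : Fin 3 → ℤ} {n : ℕ} : supNorm ω ≤ n ↔ ∀ i, (ω i).natAbs ≤ n := by
  simp [supNorm]

lemma mem_cube {ω : Fin 3 → ℤ} {n : ℕ} : ω ∈ cube n ↔ supNorm ω ≤ n := by
  rw [supNorm_le_iff, cube, Fintype.mem_piFinset]
  refine forall_congr' fun i => ?_
  rw [Finset.mem_Icc]
  omega

lemma card_cube (n : ℕ) : (cube n).card = (2 * n + 1) ^ 3 := by
  simp only [cube, Fintype.card_piFinset, Int.card_Icc, Finset.prod_const, Finset.card_univ,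
    Fintype.card_fin]
  congr 1
  omega

/-- The sphere of radius `k` for the sup norm on `ℤ³`. -/
noncomputable def shell (k : ℕ) : Finset (Fin 3 → ℤ) := (cube k).filter fun ω => supNorm ω = k

lemma card_shell_zero : (shell 0).card = 1 := by
  have h : shell 0 = cube 0 := by
    refine Finset.filter_true_of_mem fun ω hω => ?_
    have := mem_cube.1 hω
    omega
  rw [h, card_cube]
  norm_num

lemma card_shell_succ (k : ℕ) : (shell (k + 1)).card = 24 * (k + 1) ^ 2 + 2 := by
  have h : shell (k + 1) = cube (k + 1) \ cube k := by
    ext ω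
    simp only [shell, Finset.mem_filter, Finset.mem_sdiff, mem_cube]
    omega
  have hs : cube k ⊆ cube (k + 1) := fun ω hω => mem_cube.2 ((mem_cube.1 hω).trans k.le_succ)
  rw [h, Finset.card_sdiff_of_subset hs, card_cube, card_cube, Nat.sub_eq_iff_eq_add]
  · ring
  · gcongr
    omega

lemma sq_le_card_shell (k : ℕ) : ((k : ℝ) + 1) ^ 2 ≤ (shell k).card := by
  cases k with
  | zero => simp [card_shell_zero]
  | succ k =>
    rw [card_shell_succ]
    push_cast
    nlinarith [(Nat.cast_nonneg k : (0 : ℝ) ≤ k)]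

lemma card_shell_le (k : ℕ) : ((shell k).card : ℝ) ≤ 26 * ((k : ℝ) + 1) ^ 2 := by
  cases k with
  | zero => simp [card_shell_zero]
  | succ k =>
    rw [card_shell_succ]
    push_cast
    nlinarith [(Nat.cast_nonneg k : (0 : ℝ) ≤ k)]

lemma sum_cube_supNorm (n : ℕ) (h : ℕ → ℝ) :
    ∑ ω ∈ cube n, h (supNorm ω) = ∑ k ∈ Finset.range (n + 1), ((shell k).card : ℝ) * h k := by
  have hm : ∀ ω ∈ cube n, supNorm ω ∈ Finset.range (n + 1) := fun ω hω =>
    Finset.mem_range.2 (Nat.lt_succ_of_le (mem_cube.1 hω))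
  rw [← Finset.sum_fiberwise_of_maps_to hm]
  refine Finset.sum_congr rfl fun k hk => ?_
  have hs : (cube n).filter (fun ω => supNorm ω = k) = shell k := by
    ext ω
    have := Finset.mem_range.1 hk
    simp only [shell, Finset.mem_filter, mem_cube]
    omega
  rw [hs, ← nsmul_eq_mul, ← Finset.sum_const]
  refine Finset.sum_congr rfl fun ω hω => ?_
  rw [(Finset.mem_filter.1 hω).2]

lemma supNorm_sq_le (ω : Fin 3 → ℤ) : (supNorm ω : ℝ) ^ 2 ≤ ∑ i, (ω i : ℝ) ^ 2 := by
  obtain ⟨i, -, hi⟩ := Finset.exists_mem_eq_sup Finset.univ Finset.univ_nonempty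
    fun i => (ω i).natAbs
  have : (supNorm ω : ℝ) ^ 2 = (ω i : ℝ) ^ 2 := by
    rw [supNorm, hi, Nat.cast_natAbs, Int.cast_abs, sq_abs]
  rw [this]
  exact Finset.single_le_sum (f := fun i => (ω i : ℝ) ^ 2) (fun _ _ => sq_nonneg _)
    (Finset.mem_univ i)

lemma sum_sq_le_supNorm (ω : Fin 3 → ℤ) : ∑ i, (ω i : ℝ) ^ 2 ≤ 3 * (supNorm ω : ℝ) ^ 2 := by
  have h : ∀ i ∈ Finset.univ, (ω i : ℝ) ^ 2 ≤ (supNorm ω : ℝ) ^ 2 := fun i _ => by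
    have hi : ((ω i).natAbs : ℝ) ≤ supNorm ω := Nat.cast_le.2 (supNorm_le_iff.1 le_rfl i)
    rw [← sq_abs (ω i : ℝ), ← Int.cast_abs, ← Nat.cast_natAbs]
    gcongr
  simpa using Finset.sum_le_sum h

lemma le_japSq (ω : Fin 3 → ℤ) : ((supNorm ω : ℝ) + 1) ^ 2 ≤ japSq ω := by
  have h1 := supNorm_sq_le ω
  have h2 : (9 : ℝ) ≤ Real.pi ^ 2 := by nlinarith [Real.pi_gt_three]
  have h3 : 36 * (supNorm ω : ℝ) ^ 2 ≤ 4 * Real.pi ^ 2 * ∑ i, (ω i : ℝ) ^ 2 := by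
    gcongr
    linarith
  have h4 : (supNorm ω : ℝ) ≤ (supNorm ω : ℝ) ^ 2 := by
    exact_mod_cast Nat.le_self_pow two_ne_zero _
  rw [japSq]
  nlinarith

lemma japSq_le (ω : Fin 3 → ℤ) : japSq ω ≤ 192 * ((supNorm ω : ℝ) + 1) ^ 2 := by
  have h1 := sum_sq_le_supNorm ω
  have h2 : Real.pi ^ 2 ≤ 16 := by nlinarith [Real.pi_le_four, Real.pi_pos]
  have h3 : 4 * Real.pi ^ 2 * ∑ i, (ω i : ℝ) ^ 2 ≤ 4 * 16 * (3 * (supNorm ω : ℝ) ^ 2) := by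
    gcongr
  rw [japSq]
  nlinarith [(Nat.cast_nonneg (supNorm ω) : (0 : ℝ) ≤ supNorm ω)]

lemma one_le_japSq (ω : Fin 3 → ℤ) : 1 ≤ japSq ω := by
  rw [japSq]
  have : 0 ≤ 4 * Real.pi ^ 2 * ∑ i, (ω i : ℝ) ^ 2 := by positivity
  linarith

lemma japSq_add_le (x y : Fin 3 → ℤ) : japSq (x + y) ≤ 2 * (japSq x + japSq y) := by
  have h : ∑ i, (((x + y) i : ℤ) : ℝ) ^ 2 ≤ 2 * (∑ i, (x i : ℝ) ^ 2 + ∑ i, (y i : ℝ) ^ 2) := by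
    rw [← Finset.sum_add_distrib, Finset.mul_sum]
    refine Finset.sum_le_sum fun i _ => ?_
    rw [Pi.add_apply, Int.cast_add]
    nlinarith [sq_nonneg ((x i : ℝ) - y i)]
  have h' := mul_le_mul_of_nonneg_left h (by positivity : 0 ≤ 4 * Real.pi ^ 2)
  simp only [japSq] at *
  linarith

/-- The summand for the diagram `⟨22⟩`. -/
noncomputable def diagramTerm (x y : Fin 3 → ℤ) : ℝ :=
  1 / (japSq x * japSq y * (japSq x + japSq y + japSq (x + y)))

/-- A comparison kernel for `diagramTerm`, depending on the sup norms only. -/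
noncomputable def kernel (a b : ℕ) : ℝ :=
  1 / (((a : ℝ) + 1) ^ 2 * ((b : ℝ) + 1) ^ 2 * (((a : ℝ) + 1) ^ 2 + ((b : ℝ) + 1) ^ 2))

lemma kernel_nonneg (a b : ℕ) : 0 ≤ kernel a b := by
  unfold kernel
  positivity

lemma diagramTerm_nonneg (x y : Fin 3 → ℤ) : 0 ≤ diagramTerm x y := by
  have hx := one_le_japSq x
  have hy := one_le_japSq y
  have hz := one_le_japSq (x + y)
  unfold diagramTerm
  positivity

lemma diagramTerm_le (x y : Fin 3 → ℤ) : diagramTerm x y ≤ kernel (supNorm x) (supNorm y) := by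
  have hx := le_japSq x
  have hy := le_japSq y
  have hx' := one_le_japSq x
  have hy' := one_le_japSq y
  have hz := one_le_japSq (x + y)
  unfold diagramTerm kernel
  refine one_div_le_one_div_of_le (by positivity) ?_
  gcongr ?_ * ?_ * ?_
  linarith

lemma le_diagramTerm (x y : Fin 3 → ℤ) :
    1 / (3 * 192 ^ 3) * kernel (supNorm x) (supNorm y) ≤ diagramTerm x y := by
  have hx := japSq_le x
  have hy := japSq_le y
  have hx' := one_le_japSq x
  have hy' := one_le_japSq y
  have hz' := one_le_japSq (x + y)
  have hz : japSq x + japSq y + japSq (x + y) ≤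
      3 * (192 * ((supNorm x : ℝ) + 1) ^ 2 + 192 * ((supNorm y : ℝ) + 1) ^ 2) := by
    linarith [japSq_add_le x y]
  unfold diagramTerm kernel
  rw [one_div_mul_one_div]
  refine one_div_le_one_div_of_le (by positivity) ?_
  calc japSq x * japSq y * (japSq x + japSq y + japSq (x + y))
      ≤ (192 * ((supNorm x : ℝ) + 1) ^ 2) * (192 * ((supNorm y : ℝ) + 1) ^ 2) *
        (3 * (192 * ((supNorm x : ℝ) + 1) ^ 2 + 192 * ((supNorm y : ℝ) + 1) ^ 2)) := by
        gcongr
    _ = _ := by ring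

/-- The square partial sums of `1 / (a² + b²)` over positive integers. -/
noncomputable def doubleSum (L : ℕ) : ℝ :=
  ∑ a ∈ Finset.range L, ∑ b ∈ Finset.range L, 1 / (((a : ℝ) + 1) ^ 2 + ((b : ℝ) + 1) ^ 2)

lemma doubleSum_succ (L : ℕ) :
    doubleSum (L + 1) = doubleSum L
      + 2 * ∑ b ∈ Finset.range L, 1 / (((L : ℝ) + 1) ^ 2 + ((b : ℝ) + 1) ^ 2)
      + 1 / (2 * ((L : ℝ) + 1) ^ 2) := by
  have h : ∑ a ∈ Finset.range L, 1 / (((a : ℝ) + 1) ^ 2 + ((L : ℝ) + 1) ^ 2) =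
      ∑ b ∈ Finset.range L, 1 / (((L : ℝ) + 1) ^ 2 + ((b : ℝ) + 1) ^ 2) :=
    Finset.sum_congr rfl fun a _ => by rw [add_comm]
  simp only [doubleSum, Finset.sum_range_succ, Finset.sum_add_distrib]
  rw [h, two_mul (((L : ℝ) + 1) ^ 2)]
  ring

lemma doubleSum_le (L : ℕ) : doubleSum L ≤ 2 * (harmonic L : ℝ) := by
  induction L with
  | zero => simp [doubleSum]
  | succ L ih =>
    have h : ∑ b ∈ Finset.range L, 1 / (((L : ℝ) + 1) ^ 2 + ((b : ℝ) + 1) ^ 2) ≤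
        ∑ _b ∈ Finset.range L, 1 / ((L : ℝ) + 1) ^ 2 := by
      refine Finset.sum_le_sum fun b _ => ?_
      gcongr
      linarith [sq_nonneg ((b : ℝ) + 1)]
    rw [Finset.sum_const, Finset.card_range, nsmul_eq_mul] at h
    have h2 : 2 * ((L : ℝ) * (1 / ((L : ℝ) + 1) ^ 2)) + 1 / (2 * ((L : ℝ) + 1) ^ 2) ≤
        2 * ((L : ℝ) + 1)⁻¹ := by
      rw [← sub_nonneg]
      have : 2 * ((L : ℝ) + 1)⁻¹ - (2 * ((L : ℝ) * (1 / ((L : ℝ) + 1) ^ 2))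
          + 1 / (2 * ((L : ℝ) + 1) ^ 2)) = 3 / (2 * ((L : ℝ) + 1) ^ 2) := by
        field_simp
        ring
      rw [this]
      positivity
    rw [doubleSum_succ, harmonic_succ]
    push_cast
    linarith

lemma le_doubleSum (L : ℕ) : (harmonic L : ℝ) / 2 ≤ doubleSum L := by
  induction L with
  | zero => simp [doubleSum]
  | succ L ih =>
    have h : ∑ _b ∈ Finset.range L, 1 / (2 * ((L : ℝ) + 1) ^ 2) ≤
        ∑ b ∈ Finset.range L, 1 / (((L : ℝ) + 1) ^ 2 + ((b : ℝ) + 1) ^ 2) := by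
      refine Finset.sum_le_sum fun b hb => ?_
      have hb' : (b : ℝ) ≤ L := Nat.cast_le.2 (Finset.mem_range.1 hb).le
      have : ((b : ℝ) + 1) ^ 2 ≤ ((L : ℝ) + 1) ^ 2 := by gcongr
      refine one_div_le_one_div_of_le (by positivity) ?_
      linarith
    rw [Finset.sum_const, Finset.card_range, nsmul_eq_mul] at h
    have h0 : 0 ≤ (L : ℝ) * (1 / (2 * ((L : ℝ) + 1) ^ 2)) := by positivity
    have h2 : (L : ℝ) * (1 / (2 * ((L : ℝ) + 1) ^ 2)) + 1 / (2 * ((L : ℝ) + 1) ^ 2) =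
        ((L : ℝ) + 1)⁻¹ / 2 := by
      field_simp
    rw [doubleSum_succ, harmonic_succ]
    push_cast
    linarith

lemma sum_kernel_eq (n : ℕ) :
    ∑ x ∈ cube n, ∑ y ∈ cube n, kernel (supNorm x) (supNorm y) =
      ∑ a ∈ Finset.range (n + 1), ∑ b ∈ Finset.range (n + 1),
        ((shell a).card : ℝ) * (((shell b).card : ℝ) * kernel a b) := by
  rw [sum_cube_supNorm n fun a => ∑ y ∈ cube n, kernel a (supNorm y)]
  refine Finset.sum_congr rfl fun a _ => ?_
  rw [sum_cube_supNorm n fun b => kernel a b, Finset.mul_sum]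

lemma sum_kernel_le (n : ℕ) :
    ∑ x ∈ cube n, ∑ y ∈ cube n, kernel (supNorm x) (supNorm y) ≤
      26 ^ 2 * doubleSum (n + 1) := by
  rw [sum_kernel_eq, doubleSum, Finset.mul_sum]
  refine Finset.sum_le_sum fun a _ => ?_
  rw [Finset.mul_sum]
  refine Finset.sum_le_sum fun b _ => ?_
  have hk := kernel_nonneg a b
  calc ((shell a).card : ℝ) * (((shell b).card : ℝ) * kernel a b)
      ≤ (26 * ((a : ℝ) + 1) ^ 2) * ((26 * ((b : ℝ) + 1) ^ 2) * kernel a b) := by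
        gcongr
        · exact card_shell_le a
        · exact card_shell_le b
    _ = _ := by
        unfold kernel
        field_simp

lemma le_sum_kernel (n : ℕ) :
    doubleSum (n + 1) ≤ ∑ x ∈ cube n, ∑ y ∈ cube n, kernel (supNorm x) (supNorm y) := by
  rw [sum_kernel_eq, doubleSum]
  refine Finset.sum_le_sum fun a _ => Finset.sum_le_sum fun b _ => ?_
  have hk := kernel_nonneg a b
  calc 1 / (((a : ℝ) + 1) ^ 2 + ((b : ℝ) + 1) ^ 2)
      = ((a : ℝ) + 1) ^ 2 * (((b : ℝ) + 1) ^ 2 * kernel a b) := by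
        unfold kernel
        field_simp
    _ ≤ _ := by
        gcongr
        · exact sq_le_card_shell a
        · exact sq_le_card_shell b

lemma mem_cube_of_sum_sq_le {ω : Fin 3 → ℤ} {n : ℕ} (h : ∑ i, (ω i : ℝ) ^ 2 ≤ (n : ℝ) ^ 2) :
    ω ∈ cube n := by
  have := (supNorm_sq_le ω).trans h
  exact mem_cube.2 (by exact_mod_cast (sq_le_sq₀ (by positivity) (by positivity)).1 this)

lemma sum_sq_le_of_mem_cube_half {ω : Fin 3 → ℤ} {n : ℕ} (h : ω ∈ cube (n / 2)) :
    ∑ i, (ω i : ℝ) ^ 2 ≤ (n : ℝ) ^ 2 := by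
  have h1 : 2 * supNorm ω ≤ n := by
    have := mem_cube.1 h
    omega
  have h2 : 2 * (supNorm ω : ℝ) ≤ n := by exact_mod_cast h1
  have h3 : (0 : ℝ) ≤ supNorm ω := Nat.cast_nonneg _
  nlinarith [sum_sq_le_supNorm ω]

lemma harmonic_succ_le_log {n : ℕ} (hn : 2 ≤ n) :
    (harmonic (n + 1) : ℝ) ≤ 4 * Real.log n := by
  have h2 : (2 : ℝ) ≤ n := by exact_mod_cast hn
  have h := harmonic_le_one_add_log (n + 1)
  have h3 : Real.log ((n + 1 : ℕ) : ℝ) ≤ 2 * Real.log n := by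
    rw [← Real.log_rpow (by positivity)]
    refine Real.log_le_log (by positivity) ?_
    push_cast
    norm_num
    nlinarith
  have h4 := Real.log_le_log (by norm_num) h2
  linarith [Real.log_two_gt_d9]

lemma log_le_harmonic_half {n : ℕ} (hn : 2 ≤ n) :
    Real.log n / 2 ≤ (harmonic (n / 2 + 1) : ℝ) := by
  have h := log_add_one_le_harmonic (n / 2 + 1)
  have h1 : n ≤ (n / 2 + 1 + 1) ^ 2 := by
    have : n ≤ 2 * (n / 2) + 1 := by omega
    nlinarith
  have h2 : (n : ℝ) ≤ (((n / 2 + 1 + 1 : ℕ)) : ℝ) ^ 2 := by exact_mod_cast h1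
  have h3 := Real.log_le_log (by positivity) h2
  rw [Real.log_pow] at h3
  push_cast at h h3
  linarith

/-- The renormalisation sum for the diagram ⟨22⟩ diverges logarithmically: there are
constants `c₁, c₂ > 0` such that for every `n ≥ 2`,
`c₁ log n ≤ ∑_{|ω₁|,|ω₂| ≤ n} (⟨ω₁⟩² ⟨ω₂⟩² (⟨ω₁⟩² + ⟨ω₂⟩² + ⟨ω₁+ω₂⟩²))⁻¹ ≤ c₂ log n`. -/
theorem log_divergence_22 :
    ∃ c₁ c₂ : ℝ, 0 < c₁ ∧ 0 < c₂ ∧ ∀ n : ℕ, 2 ≤ n →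
      (∑' p : (Fin 3 → ℤ) × (Fin 3 → ℤ),
          if (∑ i, ((p.1 i : ℝ)) ^ 2) ≤ (n : ℝ) ^ 2 ∧ (∑ i, ((p.2 i : ℝ)) ^ 2) ≤ (n : ℝ) ^ 2 then
            1 / (japSq p.1 * japSq p.2 * (japSq p.1 + japSq p.2 + japSq (p.1 + p.2)))
          else 0)
        ∈ Set.Icc (c₁ * Real.log n) (c₂ * Real.log n) := by
  refine ⟨1 / (3 * 192 ^ 3) * (1 / 4), 26 ^ 2 * 8, by norm_num, by norm_num, fun n hn => ?_⟩
  rw [tsum_eq_sum (s := cube n ×ˢ cube n)]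
  swap
  · intro p hp
    refine if_neg fun h => hp ?_
    exact Finset.mem_product.2 ⟨mem_cube_of_sum_sq_le h.1, mem_cube_of_sum_sq_le h.2⟩
  constructor
  · have hsub : cube (n / 2) ⊆ cube n := fun ω hω =>
      mem_cube.2 ((mem_cube.1 hω).trans (Nat.div_le_self n 2))
    calc 1 / (3 * 192 ^ 3) * (1 / 4) * Real.log n
        ≤ 1 / (3 * 192 ^ 3) * doubleSum (n / 2 + 1) := by
          rw [mul_assoc]
          gcongr
          linarith [log_le_harmonic_half hn, le_doubleSum (n / 2 + 1)]
      _ ≤ 1 / (3 * 192 ^ 3) *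
          ∑ x ∈ cube (n / 2), ∑ y ∈ cube (n / 2), kernel (supNorm x) (supNorm y) := by
          gcongr
          exact le_sum_kernel _
      _ = ∑ p ∈ cube (n / 2) ×ˢ cube (n / 2),
          1 / (3 * 192 ^ 3) * kernel (supNorm p.1) (supNorm p.2) := by
          rw [← Finset.mul_sum, Finset.sum_product]
      _ ≤ _ := by
          refine le_trans ?_ (Finset.sum_le_sum_of_subset_of_nonneg
            (Finset.product_subset_product hsub hsub) fun p _ _ => ?_)
          · refine Finset.sum_le_sum fun p hp => ?_
            have hp' := Finset.mem_product.1 hp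
            rw [if_pos ⟨sum_sq_le_of_mem_cube_half hp'.1, sum_sq_le_of_mem_cube_half hp'.2⟩]
            exact le_diagramTerm p.1 p.2
          · split_ifs
            exacts [diagramTerm_nonneg _ _, le_rfl]
  · calc _ ≤ ∑ p ∈ cube n ×ˢ cube n, kernel (supNorm p.1) (supNorm p.2) := by
          refine Finset.sum_le_sum fun p _ => ?_
          split_ifs
          exacts [diagramTerm_le _ _, kernel_nonneg _ _]
      _ = ∑ x ∈ cube n, ∑ y ∈ cube n, kernel (supNorm x) (supNorm y) := Finset.sum_product _ _ _
      _ ≤ 26 ^ 2 * doubleSum (n + 1) := sum_kernel_le n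
      _ ≤ 26 ^ 2 * 8 * Real.log n := by
          linarith [harmonic_succ_le_log hn, doubleSum_le (n + 1)]
end

section
/- Let d ≥ 1 and p ∈ [1, ∞). There exists a constant C < ∞ (depending only on d and p) such that for every real R ≥ 1 and every trigonometric polynomial f on the torus 𝕋^d = (ℝ/ℤ)^d of the form f(x) = ∑_{ω ∈ ℤ^d, |ω| ≤ R} c_ω e^{2πi ω · x} (with complex coefficients c_ω), one has sup_{x ∈ 𝕋^d} |f(x)| ≤ C R^{d/p} ( ∫_{𝕋^d} |f|^p )^{1/p}. -/
open scoped BigOperators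

open MeasureTheory ComplexConjugate

/-- The character `x ↦ e^{2πi ω·x}` of `ℝ^d` with frequency `ω ∈ ℤ^d`. -/
noncomputable def trigMonomial {d : ℕ} (ω : Fin d → ℤ) (x : Fin d → ℝ) : ℂ :=
  Complex.exp (2 * Real.pi * Complex.I * ∑ i, (ω i : ℂ) * (x i : ℂ))

/-- The unit cube `[0,1]^d`. -/
def unitCube (d : ℕ) : Set (Fin d → ℝ) :=
  Set.pi Set.univ (fun _ : Fin d => Set.Icc (0 : ℝ) 1)

/-- The trigonometric polynomials with frequencies in the box `[-M,M]^d`. -/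
noncomputable def trigPolynomials (d M : ℕ) : Submodule ℂ ((Fin d → ℝ) → ℂ) :=
  Submodule.span ℂ (trigMonomial ''
    (Finset.Icc (fun _ => -(M : ℤ)) (fun _ => (M : ℤ)) : Finset (Fin d → ℤ)))

lemma trigMonomial_zero {d : ℕ} : trigMonomial (0 : Fin d → ℤ) = 1 := by
  ext x; simp [trigMonomial]

lemma trigMonomial_add {d : ℕ} (ω η : Fin d → ℤ) :
    trigMonomial (ω + η) = trigMonomial ω * trigMonomial η := by
  ext x
  simp [trigMonomial, ← Complex.exp_add, ← mul_add, ← Finset.sum_add_distrib, add_mul]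

lemma conj_trigMonomial {d : ℕ} (ω : Fin d → ℤ) (x : Fin d → ℝ) :
    conj (trigMonomial ω x) = trigMonomial (-ω) x := by
  simp [trigMonomial, ← Complex.exp_conj, Complex.conj_ofNat]

lemma norm_trigMonomial {d : ℕ} (ω : Fin d → ℤ) (x : Fin d → ℝ) : ‖trigMonomial ω x‖ = 1 := by
  have h : (2 * Real.pi * Complex.I * ∑ i, (ω i : ℂ) * (x i : ℂ)) =
      ((2 * Real.pi * ∑ i, (ω i : ℝ) * x i : ℝ) : ℂ) * Complex.I := by
    push_cast; ring
  rw [trigMonomial, h, Complex.norm_exp_ofReal_mul_I]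

@[fun_prop]
lemma continuous_trigMonomial {d : ℕ} (ω : Fin d → ℤ) : Continuous (trigMonomial ω) := by
  unfold trigMonomial; fun_prop

lemma isCompact_unitCube (d : ℕ) : IsCompact (unitCube d) :=
  isCompact_univ_pi fun _ => isCompact_Icc

lemma integral_exp_two_pi_int (n : ℤ) :
    ∫ t in Set.Icc (0 : ℝ) 1, Complex.exp (2 * Real.pi * Complex.I * ((n : ℂ) * t)) =
      if n = 0 then 1 else 0 := by
  rw [integral_Icc_eq_integral_Ioc, ← intervalIntegral.integral_of_le zero_le_one]
  split_ifs with h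
  · simp [h]
  · have hc : (2 * Real.pi * Complex.I * n : ℂ) ≠ 0 := by
      simp [Real.pi_ne_zero, h]
    simp_rw [← mul_assoc]
    rw [integral_exp_mul_complex hc]
    have := Complex.exp_int_mul_two_pi_mul_I n
    simp [show (2 * Real.pi * Complex.I * n : ℂ) = n * (2 * Real.pi * Complex.I) by ring, this]

lemma integral_trigMonomial {d : ℕ} (ω : Fin d → ℤ) :
    ∫ x in unitCube d, trigMonomial ω x = if ω = 0 then 1 else 0 := by
  simp_rw [trigMonomial, Finset.mul_sum, Complex.exp_sum]
  rw [unitCube, volume_pi, Measure.restrict_pi_pi, integral_fintype_prod_eq_prod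
    (f := fun i (t : ℝ) => Complex.exp (2 * Real.pi * Complex.I * ((ω i : ℂ) * t)))]
  simp_rw [integral_exp_two_pi_int, Finset.prod_ite_zero, funext_iff]
  simp

lemma integral_norm_sq_sum_trigMonomial {d : ℕ} (S : Finset (Fin d → ℤ)) (c : (Fin d → ℤ) → ℂ) :
    ∫ x in unitCube d, ‖∑ ω ∈ S, c ω * trigMonomial ω x‖ ^ 2 = ∑ ω ∈ S, ‖c ω‖ ^ 2 := by
  have hint (g : (Fin d → ℝ) → ℂ) (hg : Continuous g) : IntegrableOn g (unitCube d) :=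
    hg.continuousOn.integrableOn_compact (isCompact_unitCube d)
  have key (x : Fin d → ℝ) : ((‖∑ ω ∈ S, c ω * trigMonomial ω x‖ ^ 2 : ℝ) : ℂ) =
      ∑ ω ∈ S, ∑ η ∈ S, c ω * conj (c η) * trigMonomial (ω - η) x := by
    push_cast
    rw [← Complex.mul_conj', map_sum, Finset.sum_mul_sum]
    refine Finset.sum_congr rfl fun ω _ => Finset.sum_congr rfl fun η _ => ?_
    rw [map_mul, conj_trigMonomial, sub_eq_add_neg, trigMonomial_add, Pi.mul_apply]
    ring
  apply Complex.ofReal_injective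
  rw [← integral_complex_ofReal]
  simp_rw [key]
  rw [integral_finsetSum _ fun ω _ => hint _ (by fun_prop)]
  push_cast
  refine Finset.sum_congr rfl fun ω hω => ?_
  rw [integral_finsetSum _ fun η _ => hint _ (by fun_prop)]
  simp_rw [integral_const_mul, integral_trigMonomial, sub_eq_zero]
  simp [hω, Complex.mul_conj']

/-- Nikolskii's inequality between `L^∞` and `L^2`. -/
lemma norm_sq_le_of_mem_trigPolynomials {d M : ℕ} {g : (Fin d → ℝ) → ℂ}
    (hg : g ∈ trigPolynomials d M) (x : Fin d → ℝ) :
    ‖g x‖ ^ 2 ≤ (2 * M + 1) ^ d * ∫ y in unitCube d, ‖g y‖ ^ 2 := by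
  obtain ⟨c, rfl⟩ := (Submodule.mem_span_image_finset_iff_exists_fun' ℂ).1 hg
  simp only [Finset.sum_apply, Pi.smul_apply, smul_eq_mul]
  rw [integral_norm_sq_sum_trigMonomial]
  set S : Finset (Fin d → ℤ) := Finset.Icc (fun _ => -(M : ℤ)) (fun _ => (M : ℤ)) with hS
  have hcard : (S.card : ℝ) = (2 * M + 1) ^ d := by
    rw [hS, Pi.card_Icc]
    simp only [Int.card_Icc, Finset.prod_const, Finset.card_univ, Fintype.card_fin]
    rw [show ((M : ℤ) + 1 - -M).toNat = 2 * M + 1 by omega]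
    push_cast; rfl
  calc ‖∑ ω ∈ S, c ω * trigMonomial ω x‖ ^ 2 ≤ (∑ ω ∈ S, ‖c ω‖) ^ 2 := by
        gcongr
        refine (norm_sum_le _ _).trans_eq ?_
        simp [norm_trigMonomial]
    _ ≤ (2 * M + 1) ^ d * ∑ ω ∈ S, ‖c ω‖ ^ 2 := by
        rw [← hcard]; exact sq_sum_le_card_mul_sum_sq

lemma pow_mem_trigPolynomials {d M : ℕ} {f : (Fin d → ℝ) → ℂ}
    (hf : f ∈ trigPolynomials d M) (k : ℕ) : f ^ k ∈ trigPolynomials d (k * M) := by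
  induction k with
  | zero =>
    rw [pow_zero, ← trigMonomial_zero]
    exact Submodule.subset_span ⟨0, Finset.mem_coe.2 (Finset.mem_Icc.2 ⟨fun _ => by simp, fun _ => by simp⟩), rfl⟩
  | succ k ih =>
    have h := Submodule.mul_mem_mul ih hf
    rw [← pow_succ, trigPolynomials, trigPolynomials, Submodule.span_mul_span] at h
    refine Submodule.span_mono ?_ h
    rintro _ ⟨_, ⟨ω, hω, rfl⟩, _, ⟨η, hη, rfl⟩, rfl⟩
    refine ⟨ω + η, ?_, trigMonomial_add ω η⟩
    simp only [Finset.coe_Icc, Set.mem_Icc, Pi.le_def, Pi.add_apply] at hω hη ⊢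
    push_cast at hω hη ⊢
    exact ⟨fun i => by linarith [hω.1 i, hη.1 i], fun i => by linarith [hω.2 i, hη.2 i]⟩

lemma continuous_of_mem_trigPolynomials {d M : ℕ} {f : (Fin d → ℝ) → ℂ}
    (hf : f ∈ trigPolynomials d M) : Continuous f := by
  obtain ⟨c, rfl⟩ := (Submodule.mem_span_image_finset_iff_exists_fun' ℂ).1 hf
  simp only [Finset.sum_fn]
  fun_prop

lemma bddAbove_norm_of_mem_trigPolynomials {d M : ℕ} {f : (Fin d → ℝ) → ℂ}
    (hf : f ∈ trigPolynomials d M) : BddAbove (Set.range fun x => ‖f x‖) := by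
  obtain ⟨c, rfl⟩ := (Submodule.mem_span_image_finset_iff_exists_fun' ℂ).1 hf
  refine ⟨∑ ω ∈ Finset.Icc (fun _ => -(M : ℤ)) (fun _ => (M : ℤ)), ‖c ω‖, ?_⟩
  rintro _ ⟨x, rfl⟩
  simp only [Finset.sum_apply, Pi.smul_apply, smul_eq_mul]
  refine (norm_sum_le _ _).trans_eq ?_
  simp [norm_trigMonomial]

/-- Nikolskii's inequality between `L^∞` and `L^p`, obtained by applying the `L^2` case to a power
of the polynomial. -/
lemma norm_rpow_le_of_mem_trigPolynomials {d M k : ℕ} {p : ℝ} (hp : 0 < p) (hk : p ≤ 2 * k)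
    {f : (Fin d → ℝ) → ℂ} (hf : f ∈ trigPolynomials d M) (x : Fin d → ℝ) :
    ‖f x‖ ^ p ≤ (2 * (k * M : ℕ) + 1) ^ d * ∫ y in unitCube d, ‖f y‖ ^ p := by
  have hcont := continuous_of_mem_trigPolynomials hf
  have hbdd := bddAbove_norm_of_mem_trigPolynomials hf
  set A : ℝ := ⨆ x, ‖f x‖
  have hA (y : Fin d → ℝ) : ‖f y‖ ≤ A := le_ciSup hbdd y
  have hint (g : (Fin d → ℝ) → ℝ) (hg : Continuous g) : IntegrableOn g (unitCube d) :=
    hg.continuousOn.integrableOn_compact (isCompact_unitCube d)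
  set I := ∫ y in unitCube d, ‖f y‖ ^ p
  have hI : 0 ≤ I := integral_nonneg fun y => by positivity
  rcases ((norm_nonneg _).trans (hA x)).eq_or_lt with hA0 | hA0
  · have : ‖f x‖ = 0 := le_antisymm (hA0 ▸ hA x) (norm_nonneg _)
    rw [this, Real.zero_rpow hp.ne']
    positivity
  have hk0 : (0 : ℝ) < 2 * k := hp.trans_le hk
  set B : ℝ := (2 * (k * M : ℕ) + 1) ^ d * (A ^ (2 * k - p) * I)
  have hB : 0 ≤ B := by positivity
  have hpt (y : Fin d → ℝ) : ‖f y‖ ^ (2 * k : ℝ) ≤ B := by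
    have hpow (z : Fin d → ℝ) : ‖f z‖ ^ (2 * k : ℝ) = ‖(f ^ k) z‖ ^ 2 := by
      rw [Pi.pow_apply, norm_pow, ← pow_mul, ← Real.rpow_natCast]
      push_cast; ring_nf
    rw [hpow]
    refine (norm_sq_le_of_mem_trigPolynomials (pow_mem_trigPolynomials hf k) y).trans ?_
    refine mul_le_mul_of_nonneg_left ?_ (by positivity)
    rw [← integral_const_mul]
    refine integral_mono (hint _ (by fun_prop))
      (hint _ (continuous_const.mul (hcont.norm.rpow_const fun _ => .inr hp.le))) fun z => ?_
    simp only
    rw [← hpow, ← sub_add_cancel (2 * k : ℝ) p,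
      Real.rpow_add_of_nonneg (norm_nonneg _) (sub_nonneg.2 hk) hp.le, sub_add_cancel]
    exact mul_le_mul_of_nonneg_right
      (Real.rpow_le_rpow (norm_nonneg _) (hA z) (sub_nonneg.2 hk)) (by positivity)
  have hAB : A ^ (2 * k : ℝ) ≤ B := by
    rw [← Real.le_rpow_inv_iff_of_pos hA0.le hB hk0]
    exact ciSup_le fun y => (Real.le_rpow_inv_iff_of_pos (norm_nonneg _) hB hk0).2 (hpt y)
  refine (Real.rpow_le_rpow (norm_nonneg _) (hA x) hp.le).trans ?_
  have hpos : 0 < A ^ (2 * k - p) := by positivity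
  refine le_of_mul_le_mul_left ?_ hpos
  rw [← Real.rpow_add hA0, sub_add_cancel]
  exact hAB.trans_eq (mul_left_comm _ _ _)

/-- Bernstein (Nikolskii) inequality on the torus: a trigonometric polynomial
`f(x) = ∑_{|ω| ≤ R} c_ω e^{2πi ω·x}` satisfies
`sup_x |f(x)| ≤ C R^{d/p} (∫_{[0,1]^d} |f|^p)^{1/p}`, with `C` depending only on `d, p`. -/
theorem bernstein_inequality (d : ℕ) (hd : 1 ≤ d) (p : ℝ) (hp : 1 ≤ p) :
    ∃ C : ℝ, ∀ R : ℝ, 1 ≤ R → ∀ c : (Fin d → ℤ) → ℂ,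
      (∀ ω : Fin d → ℤ, R ^ 2 < (∑ i, ((ω i : ℝ)) ^ 2) → c ω = 0) →
      ∀ x : Fin d → ℝ,
        ‖∑' ω : Fin d → ℤ, c ω *
            Complex.exp (2 * Real.pi * Complex.I * ∑ i, (ω i : ℂ) * (x i : ℂ))‖
          ≤ C * R ^ ((d : ℝ) / p) *
            (∫ y in Set.pi Set.univ (fun _ : Fin d => Set.Icc (0 : ℝ) 1),
              ‖∑' ω : Fin d → ℤ, c ω *
                  Complex.exp (2 * Real.pi * Complex.I * ∑ i, (ω i : ℂ) * (y i : ℂ))‖ ^ p)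
              ^ (1 / p) := by
  have hp0 : 0 < p := by linarith
  obtain ⟨k, hk⟩ := exists_nat_ge p
  have hk1 : (1 : ℝ) ≤ k := hp.trans hk
  refine ⟨(3 * k : ℝ) ^ ((d : ℝ) / p), fun R hR c hc x => ?_⟩
  set M := ⌊R⌋₊
  have hM : (M : ℝ) ≤ R := Nat.floor_le (by linarith)
  let f : (Fin d → ℝ) → ℂ := fun y => ∑' ω : Fin d → ℤ, c ω * trigMonomial ω y
  have hf : f ∈ trigPolynomials d M := by
    refine (Submodule.mem_span_image_finset_iff_exists_fun' ℂ).2 ⟨c, ?_⟩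
    ext y
    simp only [Finset.sum_apply, Pi.smul_apply, smul_eq_mul]
    refine (tsum_eq_sum fun ω hω => ?_).symm
    rw [hc ω, zero_mul]
    by_contra! hle
    refine hω (Finset.mem_Icc.2 ?_)
    have habs (i : Fin d) : |ω i| ≤ (M : ℤ) := by
      have h1 : (ω i : ℝ) ^ 2 ≤ R ^ 2 :=
        (Finset.single_le_sum (f := fun i => (ω i : ℝ) ^ 2) (fun _ _ => sq_nonneg _)
          (Finset.mem_univ i)).trans hle
      have h2 : |(ω i : ℝ)| ≤ R := abs_le_of_sq_le_sq h1 (by linarith)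
      have h3 : (ω i).natAbs ≤ M := Nat.le_floor (by rwa [Nat.cast_natAbs, Int.cast_abs])
      rw [Int.abs_eq_natAbs]
      exact_mod_cast h3
    exact ⟨fun i => (abs_le.1 (habs i)).1, fun i => (abs_le.1 (habs i)).2⟩
  change ‖f x‖ ≤ _ * (∫ y in unitCube d, ‖f y‖ ^ p) ^ (1 / p)
  have hI : 0 ≤ ∫ y in unitCube d, ‖f y‖ ^ p := integral_nonneg fun y => by positivity
  have hmain := norm_rpow_le_of_mem_trigPolynomials hp0 (show p ≤ 2 * k by linarith) hf x
  have hbase : (2 * (k * M : ℕ) + 1 : ℝ) ≤ 3 * k * R := by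
    push_cast
    nlinarith [mul_le_mul_of_nonneg_left hM (zero_le_one.trans hk1)]
  have hle : ‖f x‖ ^ p ≤ (3 * k * R) ^ (d : ℝ) * ∫ y in unitCube d, ‖f y‖ ^ p := by
    rw [Real.rpow_natCast]
    refine hmain.trans ?_
    gcongr
  rw [← Real.le_rpow_inv_iff_of_pos (norm_nonneg _) (by positivity) hp0,
    Real.mul_rpow (by positivity) hI, ← Real.rpow_mul (by positivity),
    Real.mul_rpow (by positivity) (by positivity)] at hle
  simpa only [div_eq_mul_inv, one_mul] using hle
end

section
/- For every n ≥ 1 and every p ∈ [2, ∞) there exists a constant C < ∞ (depending only on n and p) such that for every dimension m ≥ 1 and every real polynomial Q in m variables of total degree at most n, letting γ_m denote the standard Gaussian measure on ℝ^m, one has ( ∫_{ℝ^m} |Q|^p dγ_m )^{1/p} ≤ C ( ∫_{ℝ^m} Q² dγ_m )^{1/2}. -/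
open MeasureTheory ProbabilityTheory

/-- The standard Gaussian measure on `ℝ^m`. -/
noncomputable def stdGaussianPi (m : ℕ) : Measure (Fin m → ℝ) :=
  Measure.pi fun _ => gaussianReal 0 1

namespace MvPolynomial

section General

variable {σ : Type*}

theorem pderiv_comm (i j : σ) (P : MvPolynomial σ ℝ) :
    pderiv i (pderiv j P) = pderiv j (pderiv i P) := by
  classical
  let D (l : σ) : Derivation ℝ (MvPolynomial σ ℝ) (MvPolynomial σ ℝ) := pderiv l
  have h : ⁅D i, D j⁆ = 0 := by
    refine derivation_ext fun k => ?_
    simp [D, Derivation.commutator_apply, pderiv_X, Pi.single_apply, apply_ite]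
  have := DFunLike.congr_fun h P
  simpa [D, Derivation.commutator_apply, sub_eq_zero] using this

theorem totalDegree_pderiv_le (i : σ) (P : MvPolynomial σ ℝ) :
    (pderiv i P).totalDegree ≤ P.totalDegree - 1 := by
  conv_lhs => rw [← sum_homogeneousComponent P, map_sum]
  refine totalDegree_finsetSum_le fun k hk => ?_
  have := (homogeneousComponent_isHomogeneous k P).pderiv (i := i) |>.totalDegree_le
  have := Finset.mem_range.1 hk
  omega

/-- A positive unital linear functional on polynomials satisfying Gaussian integration by parts. -/
structure IsGaussianFunctional (E : MvPolynomial σ ℝ →ₗ[ℝ] ℝ) : Prop where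
  map_one : E 1 = 1
  map_mul_self_nonneg (P : MvPolynomial σ ℝ) : 0 ≤ E (P * P)
  map_X_mul (i : σ) (P : MvPolynomial σ ℝ) : E (X i * P) = E (pderiv i P)

namespace IsGaussianFunctional

variable {E : MvPolynomial σ ℝ →ₗ[ℝ] ℝ} (hE : IsGaussianFunctional E)
include hE

theorem map_C (c : ℝ) : E (C c) = c := by
  rw [← mul_one (C c), ← smul_eq_C_mul, map_smul, hE.map_one, smul_eq_mul, mul_one]

/-- The Cauchy–Schwarz inequality. -/
theorem sq_map_mul_le (P Q : MvPolynomial σ ℝ) : E (P * Q) ^ 2 ≤ E (P * P) * E (Q * Q) := by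
  have h := discrim_le_zero (a := E (P * P)) (b := 2 * E (P * Q)) (c := E (Q * Q)) fun t => by
    have h := hE.map_mul_self_nonneg (t • P + Q)
    rw [show (t • P + Q) * (t • P + Q)
      = (t * t) • (P * P) + (2 * t) • (P * Q) + Q * Q by
        simp only [smul_eq_C_mul, C_mul, map_ofNat]; ring,
      map_add, map_add, map_smul, map_smul] at h
    simp only [smul_eq_mul] at h
    linarith
  rw [discrim] at h
  linarith

theorem two_mul_map_mul_le (P Q : MvPolynomial σ ℝ) :
    2 * E (P * Q) ≤ E (P * P) + E (Q * Q) := by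
  have h := hE.map_mul_self_nonneg (P - Q)
  rw [show (P - Q) * (P - Q) = P * P + Q * Q - (2 : ℝ) • (P * Q) by
    simp only [smul_eq_C_mul, map_ofNat]; ring, map_sub, map_add, map_smul, smul_eq_mul] at h
  linarith

end IsGaussianFunctional

end General

variable {σ : Type*} [Fintype σ]

/-- The Ornstein–Uhlenbeck operator `x · ∇ - Δ` on polynomials. -/
noncomputable def ornsteinUhlenbeck : MvPolynomial σ ℝ →ₗ[ℝ] MvPolynomial σ ℝ where
  toFun P := ∑ i, (X i * pderiv i P - pderiv i (pderiv i P))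
  map_add' P Q := by
    rw [← Finset.sum_add_distrib]
    refine Finset.sum_congr rfl fun i _ => ?_
    simp only [map_add]
    ring
  map_smul' c P := by
    simp only [RingHom.id_apply, Finset.smul_sum, Derivation.map_smul, smul_sub, mul_smul_comm]

theorem ornsteinUhlenbeck_apply (P : MvPolynomial σ ℝ) :
    ornsteinUhlenbeck P = ∑ i, (X i * pderiv i P - pderiv i (pderiv i P)) := rfl

theorem pderiv_ornsteinUhlenbeck (j : σ) (P : MvPolynomial σ ℝ) :
    pderiv j (ornsteinUhlenbeck P) = ornsteinUhlenbeck (pderiv j P) + pderiv j P := by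
  classical
  have h : pderiv j P = ∑ i, pderiv j (X i) * pderiv i P := by
    simp [pderiv_X, Pi.single_apply]
  refine Eq.trans ?_ (congrArg (ornsteinUhlenbeck (pderiv j P) + ·) h.symm)
  rw [ornsteinUhlenbeck_apply, ornsteinUhlenbeck_apply, map_sum, ← Finset.sum_add_distrib]
  refine Finset.sum_congr rfl fun i _ => ?_
  rw [map_sub, pderiv_mul, pderiv_comm j i (pderiv i P), pderiv_comm j i P]
  ring

theorem IsHomogeneous.exists_ornsteinUhlenbeck_add_C {k : ℕ} {P : MvPolynomial σ ℝ}
    (hP : P.IsHomogeneous k) : ∃ (u : MvPolynomial σ ℝ) (c : ℝ), P = ornsteinUhlenbeck u + C c := by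
  induction k using Nat.strong_induction_on generalizing P with
  | _ k ih =>
    rcases Nat.eq_zero_or_pos k with rfl | hk
    · exact ⟨0, P.coeff 0, by
        rw [map_zero, zero_add]
        exact totalDegree_eq_zero_iff_eq_C.1 ((totalDegree_zero_iff_isHomogeneous σ).2 hP)⟩
    · obtain ⟨v, c, hv⟩ := ih (k - 1 - 1) (by omega)
        (IsHomogeneous.sum Finset.univ (fun i => pderiv i (pderiv i P)) _
          fun i _ => hP.pderiv.pderiv)
      have hk' : (k : ℝ) ≠ 0 := by positivity
      have hL : ornsteinUhlenbeck P = (k : ℝ) • P - (ornsteinUhlenbeck v + C c) := by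
        rw [ornsteinUhlenbeck_apply, Finset.sum_sub_distrib, hP.sum_X_mul_pderiv, hv,
          Nat.cast_smul_eq_nsmul]
      refine ⟨(k : ℝ)⁻¹ • (P + v), (k : ℝ)⁻¹ * c, ?_⟩
      rw [map_smul, map_add, hL, MvPolynomial.C_mul, ← smul_eq_C_mul (C c), ← smul_add]
      rw [show (k : ℝ) • P - (ornsteinUhlenbeck v + C c) + ornsteinUhlenbeck v + C c
        = (k : ℝ) • P by ring, smul_smul, inv_mul_cancel₀ hk', one_smul]

theorem exists_ornsteinUhlenbeck_add_C (P : MvPolynomial σ ℝ) :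
    ∃ (u : MvPolynomial σ ℝ) (c : ℝ), P = ornsteinUhlenbeck u + C c := by
  choose u c h using fun k =>
    (homogeneousComponent_isHomogeneous k P).exists_ornsteinUhlenbeck_add_C
  refine ⟨∑ k ∈ Finset.range (P.totalDegree + 1), u k,
    ∑ k ∈ Finset.range (P.totalDegree + 1), c k, ?_⟩
  conv_lhs => rw [← sum_homogeneousComponent P]
  simp_rw [map_sum, ← Finset.sum_add_distrib, ← h]

namespace IsGaussianFunctional

variable {E : MvPolynomial σ ℝ →ₗ[ℝ] ℝ} (hE : IsGaussianFunctional E)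
include hE

theorem map_mul_ornsteinUhlenbeck (P Q : MvPolynomial σ ℝ) :
    E (P * ornsteinUhlenbeck Q) = ∑ i, E (pderiv i P * pderiv i Q) := by
  rw [ornsteinUhlenbeck_apply, Finset.mul_sum, map_sum]
  refine Finset.sum_congr rfl fun i _ => ?_
  rw [mul_sub, map_sub, mul_left_comm, hE.map_X_mul, pderiv_mul, map_add]
  ring

theorem map_ornsteinUhlenbeck_mul_self (P : MvPolynomial σ ℝ) :
    E (ornsteinUhlenbeck P * ornsteinUhlenbeck P)
      = ∑ j, ∑ i, E (pderiv i (pderiv j P) * pderiv i (pderiv j P))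
        + ∑ j, E (pderiv j P * pderiv j P) := by
  rw [hE.map_mul_ornsteinUhlenbeck, ← Finset.sum_add_distrib]
  refine Finset.sum_congr rfl fun j _ => ?_
  rw [pderiv_ornsteinUhlenbeck, add_mul, map_add, mul_comm, hE.map_mul_ornsteinUhlenbeck]

/-- The Gaussian Poincaré inequality for polynomials. -/
theorem poincare (P : MvPolynomial σ ℝ) :
    E (P * P) ≤ E P ^ 2 + ∑ i, E (pderiv i P * pderiv i P) := by
  obtain ⟨u, c, rfl⟩ := exists_ornsteinUhlenbeck_add_C P
  set v := ornsteinUhlenbeck u with hv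
  have hv0 : E v = 0 := by simpa using hE.map_mul_ornsteinUhlenbeck 1 u
  have hsq : E ((v + C c) * (v + C c)) = E (v * v) + c ^ 2 := by
    rw [show (v + C c) * (v + C c) = v * v + (2 * c) • v + c • C c by
      simp only [smul_eq_C_mul, C_mul, map_ofNat]; ring, map_add, map_add, map_smul, map_smul, hv0, hE.map_C,
      smul_zero, smul_eq_mul]
    ring
  have hvv : E (v * v) = ∑ i, E (pderiv i v * pderiv i u) := hE.map_mul_ornsteinUhlenbeck v u
  have hu : ∑ i, E (pderiv i u * pderiv i u) ≤ E (v * v) := by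
    rw [hv, hE.map_ornsteinUhlenbeck_mul_self]
    exact le_add_of_nonneg_left <| Finset.sum_nonneg fun j _ => Finset.sum_nonneg fun i _ =>
      hE.map_mul_self_nonneg _
  have hamgm : 2 * E (v * v)
      ≤ ∑ i, E (pderiv i v * pderiv i v) + ∑ i, E (pderiv i u * pderiv i u) := by
    rw [hvv, Finset.mul_sum, ← Finset.sum_add_distrib]
    exact Finset.sum_le_sum fun i _ => hE.two_mul_map_mul_le _ _
  simp only [hsq, map_add, hv0, hE.map_C, zero_add, pderiv_C, add_zero]
  linarith

/-- The reverse Poincaré inequality for polynomials of bounded degree. -/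
theorem reverse_poincare {n : ℕ} {P : MvPolynomial σ ℝ} (hP : P.totalDegree ≤ n) :
    ∑ i, E (pderiv i P * pderiv i P) ≤ n * E (P * P) := by
  induction n generalizing P with
  | zero =>
    rw [totalDegree_eq_zero_iff_eq_C.1 (Nat.le_zero.1 hP)]
    simp
  | succ n ih =>
    set A := ∑ i, E (pderiv i P * pderiv i P) with hA
    have hPL : E (P * ornsteinUhlenbeck P) = A := hE.map_mul_ornsteinUhlenbeck P P
    have hLL : E (ornsteinUhlenbeck P * ornsteinUhlenbeck P) ≤ (n + 1) * A := by
      rw [hE.map_ornsteinUhlenbeck_mul_self, add_one_mul, hA, Finset.mul_sum]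
      gcongr with j
      exact ih ((totalDegree_pderiv_le j P).trans (by omega))
    have h := hE.two_mul_map_mul_le ((n + 1 : ℝ) • P) (ornsteinUhlenbeck P)
    simp only [smul_mul_assoc, mul_smul_comm, map_smul, smul_eq_mul, hPL] at h
    have hn : (0 : ℝ) < n + 1 := by positivity
    push_cast
    refine le_of_mul_le_mul_left ?_ hn
    linarith

end IsGaussianFunctional

/-- The constant in the `L⁴`-`L²` comparison for Gaussian polynomials of degree at most `n`. -/
def fourthMomentConst : ℕ → ℝ
  | 0 => 1
  | n + 1 => 1 + 4 * (n + 1) * fourthMomentConst n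

theorem fourthMomentConst_nonneg (n : ℕ) : 0 ≤ fourthMomentConst n := by
  induction n with
  | zero => simp [fourthMomentConst]
  | succ n ih => rw [fourthMomentConst]; positivity

namespace IsGaussianFunctional

variable {E : MvPolynomial σ ℝ →ₗ[ℝ] ℝ} (hE : IsGaussianFunctional E)
include hE

theorem fourth_moment_le {n : ℕ} {P : MvPolynomial σ ℝ} (hP : P.totalDegree ≤ n) :
    E ((P * P) * (P * P)) ≤ (fourthMomentConst n * E (P * P)) ^ 2 := by
  induction n generalizing P with
  | zero =>
    rw [totalDegree_eq_zero_iff_eq_C.1 (Nat.le_zero.1 hP)]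
    simp only [← C_mul, hE.map_C, fourthMomentConst]
    exact le_of_eq (by ring)
  | succ n ih =>
    have hK := fourthMomentConst_nonneg n
    set K := fourthMomentConst n with hKdef
    set S := E (P * P) with hS
    set Y := √(E ((P * P) * (P * P))) with hY
    have hS0 : 0 ≤ S := hE.map_mul_self_nonneg P
    have hY0 : 0 ≤ Y := Real.sqrt_nonneg _
    have hYsq : Y ^ 2 = E ((P * P) * (P * P)) := Real.sq_sqrt (hE.map_mul_self_nonneg _)
    have hterm (i : σ) : E (pderiv i (P * P) * pderiv i (P * P))
        ≤ 4 * (Y * (K * E (pderiv i P * pderiv i P))) := by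
      set D := pderiv i P with hD
      have hDS : 0 ≤ E (D * D) := hE.map_mul_self_nonneg D
      have hcs := hE.sq_map_mul_le (P * P) (D * D)
      have hD4 := ih (P := D) ((totalDegree_pderiv_le i P).trans (by omega))
      have h : E ((P * P) * (D * D)) ≤ Y * (K * E (D * D)) := by
        refine abs_le_of_sq_le_sq' (hcs.trans ?_) (by positivity) |>.2
        rw [mul_pow, hYsq]
        exact mul_le_mul_of_nonneg_left hD4 (hE.map_mul_self_nonneg _)
      rw [show pderiv i (P * P) * pderiv i (P * P) = (4 : ℝ) • ((P * P) * (D * D)) by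
        rw [pderiv_mul, smul_eq_C_mul, map_ofNat]; ring, map_smul, smul_eq_mul]
      linarith
    have hmain : Y ^ 2 ≤ S ^ 2 + 4 * (n + 1) * K * S * Y := by
      have hp := hE.poincare (P * P)
      have hsum := Finset.sum_le_sum fun i (_ : i ∈ Finset.univ) => hterm i
      have hrev := mul_le_mul_of_nonneg_left (hE.reverse_poincare hP)
        (show 0 ≤ 4 * Y * K by positivity)
      simp_rw [← Finset.mul_sum] at hsum
      push_cast at hrev
      rw [hYsq]
      linarith
    rw [← hYsq, fourthMomentConst]
    refine pow_le_pow_left₀ hY0 ?_ 2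
    by_contra! hlt
    have hB : 0 ≤ 4 * (n + 1) * K * S := by positivity
    nlinarith

end IsGaussianFunctional

theorem exists_moment_le (k n : ℕ) : ∃ K : ℝ, 0 ≤ K ∧
    ∀ (m : ℕ) (E : MvPolynomial (Fin m) ℝ →ₗ[ℝ] ℝ), IsGaussianFunctional E →
      ∀ P : MvPolynomial (Fin m) ℝ, P.totalDegree ≤ n →
        E (P ^ 2 ^ (k + 1)) ≤ (K * E (P ^ 2)) ^ 2 ^ k := by
  induction k generalizing n with
  | zero => exact ⟨1, zero_le_one, by simp⟩
  | succ k ih =>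
    obtain ⟨K, hK, h⟩ := ih (2 * n)
    have hF := fourthMomentConst_nonneg n
    refine ⟨(K + 1) * fourthMomentConst n, by positivity, fun m E hE P hP => ?_⟩
    have hdeg : (P ^ 2).totalDegree ≤ 2 * n := (totalDegree_pow P 2).trans (by omega)
    have h4 := hE.fourth_moment_le hP
    have h40 := hE.map_mul_self_nonneg (P * P)
    have hKK : K ≤ (K + 1) ^ 2 := by nlinarith
    simp only [← pow_two] at h4 h40
    calc E (P ^ 2 ^ (k + 1 + 1)) = E ((P ^ 2) ^ 2 ^ (k + 1)) := by rw [← pow_mul, ← pow_succ']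
      _ ≤ (K * E ((P ^ 2) ^ 2)) ^ 2 ^ k := h m E hE _ hdeg
      _ ≤ ((K + 1) ^ 2 * (fourthMomentConst n * E (P ^ 2)) ^ 2) ^ 2 ^ k := by gcongr
      _ = ((K + 1) * fourthMomentConst n * E (P ^ 2)) ^ 2 ^ (k + 1) := by
        rw [← mul_pow, ← pow_mul, ← pow_succ', mul_assoc]

end MvPolynomial

theorem integrable_pow_gaussianReal (k : ℕ) :
    Integrable (fun x : ℝ => x ^ k) (gaussianReal 0 1) := by
  rcases Nat.eq_zero_or_pos k with rfl | hk
  · simp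
  · have h := (memLp_id_gaussianReal' (μ := 0) (v := 1) k (by simp)).integrable_norm_pow hk.ne'
    exact (integrable_norm_iff (by fun_prop)).1 (by simpa using h)

/-- Gaussian integration by parts for powers. -/
theorem integral_pow_succ_gaussianReal (k : ℕ) :
    ∫ x, x ^ (k + 1) ∂gaussianReal 0 1 = k * ∫ x, x ^ (k - 1) ∂gaussianReal 0 1 := by
  have hint (j : ℕ) : Integrable fun x : ℝ => x ^ j * gaussianPDFReal 0 1 x := by
    have h := integrable_pow_gaussianReal j
    rw [gaussianReal_of_var_ne_zero 0 one_ne_zero,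
      integrable_withDensity_iff (measurable_gaussianPDF 0 1) (by simp [gaussianPDF])] at h
    simpa [toReal_gaussianPDF] using h
  have hderiv (x : ℝ) : HasDerivAt (fun x => -gaussianPDFReal 0 1 x)
      (x * gaussianPDFReal 0 1 x) x := by
    have h : HasDerivAt (fun x : ℝ => -(x - 0) ^ 2 / (2 * (1 : NNReal))) (-x) x := by
      have := (((hasDerivAt_id x).sub_const 0).pow 2).neg.div_const (2 * ((1 : NNReal) : ℝ))
      refine this.congr_deriv ?_
      simp
      ring
    have := (h.exp.const_mul (√(2 * Real.pi * (1 : NNReal)))⁻¹).neg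
    refine this.congr_deriv ?_
    rw [gaussianPDFReal]
    ring
  have h := integral_mul_deriv_eq_deriv_mul_of_integrable
    (u := fun x : ℝ => x ^ k) (u' := fun x => k * x ^ (k - 1))
    (v := fun x => -gaussianPDFReal 0 1 x) (v' := fun x => x * gaussianPDFReal 0 1 x)
    (fun x _ => by simpa using hasDerivAt_pow k x) (fun x _ => hderiv x)
    ((hint (k + 1)).congr (.of_forall fun x => by simp [pow_succ, mul_assoc]))
    (((hint (k - 1)).const_mul (-k)).congr (.of_forall fun x => by simp [mul_assoc]))
    ((hint k).neg.congr (.of_forall fun x => by simp))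
  simp only [integral_gaussianReal_eq_integral_smul one_ne_zero, smul_eq_mul]
  rw [← integral_const_mul, ← integral_neg] at *
  refine Eq.trans (integral_congr_ae (.of_forall fun x => ?_))
    (h.trans (integral_congr_ae (.of_forall fun x => ?_)))
  · simp only [pow_succ]; ring
  · simp only; ring

section Gaussian

variable {m : ℕ}

instance : IsProbabilityMeasure (stdGaussianPi m) :=
  inferInstanceAs (IsProbabilityMeasure (Measure.pi fun _ => gaussianReal 0 1))

theorem eval_monomial_eq_prod (s : Fin m →₀ ℕ) (a : ℝ) (x : Fin m → ℝ) :
    MvPolynomial.eval x (MvPolynomial.monomial s a) = a * ∏ i, x i ^ s i := by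
  rw [MvPolynomial.eval_monomial, Finsupp.prod_fintype _ _ fun _ => pow_zero _]

theorem integrable_eval_stdGaussianPi (P : MvPolynomial (Fin m) ℝ) :
    Integrable (fun x => MvPolynomial.eval x P) (stdGaussianPi m) := by
  induction P using MvPolynomial.induction_on' with
  | monomial s a =>
    simp_rw [eval_monomial_eq_prod]
    exact (Integrable.fintype_prod fun i => integrable_pow_gaussianReal (s i)).const_mul a
  | add P Q hP hQ => simp only [map_add]; exact hP.add hQ

/-- Expectation of polynomials under the standard Gaussian measure. -/
noncomputable def gaussianExpectation (m : ℕ) : MvPolynomial (Fin m) ℝ →ₗ[ℝ] ℝ where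
  toFun P := ∫ x, MvPolynomial.eval x P ∂stdGaussianPi m
  map_add' P Q := by
    simp only [map_add]
    exact integral_add (integrable_eval_stdGaussianPi P) (integrable_eval_stdGaussianPi Q)
  map_smul' c P := by simp [integral_const_mul]

theorem gaussianExpectation_apply (P : MvPolynomial (Fin m) ℝ) :
    gaussianExpectation m P = ∫ x, MvPolynomial.eval x P ∂stdGaussianPi m := rfl

theorem gaussianExpectation_monomial (s : Fin m →₀ ℕ) (a : ℝ) :
    gaussianExpectation m (MvPolynomial.monomial s a)
      = a * ∏ i, ∫ x, x ^ s i ∂gaussianReal 0 1 := by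
  simp_rw [gaussianExpectation_apply, eval_monomial_eq_prod, integral_const_mul, stdGaussianPi]
  rw [integral_fintype_prod_eq_prod (fun i (x : ℝ) => x ^ s i)]

theorem isGaussianFunctional_gaussianExpectation :
    MvPolynomial.IsGaussianFunctional (gaussianExpectation m) where
  map_one := by simp [gaussianExpectation_apply]
  map_mul_self_nonneg P := by
    rw [gaussianExpectation_apply]
    exact integral_nonneg fun x => by simpa using mul_self_nonneg _
  map_X_mul i P := by
    induction P using MvPolynomial.induction_on' with
    | monomial s a =>
      rw [MvPolynomial.pderiv_monomial, MvPolynomial.X, MvPolynomial.monomial_mul,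
        gaussianExpectation_monomial, gaussianExpectation_monomial,
        ← Finset.mul_prod_erase _ _ (Finset.mem_univ i),
        ← Finset.mul_prod_erase _ _ (Finset.mem_univ i)]
      have h : ∏ j ∈ Finset.univ.erase i,
            ∫ x, x ^ (Finsupp.single i 1 + s : Fin m →₀ ℕ) j ∂gaussianReal 0 1
          = ∏ j ∈ Finset.univ.erase i,
            ∫ x, x ^ (s - Finsupp.single i 1 : Fin m →₀ ℕ) j ∂gaussianReal 0 1 := by
        refine Finset.prod_congr rfl fun j hj => ?_
        simp [Finsupp.single_eq_of_ne (Finset.ne_of_mem_erase hj)]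
      rw [h]
      simp only [Finsupp.add_apply, Finsupp.tsub_apply, Finsupp.single_eq_same, add_comm 1,
        integral_pow_succ_gaussianReal]
      ring
    | add P Q hP hQ => simp only [mul_add, map_add, hP, hQ]

theorem memLp_eval_stdGaussianPi (P : MvPolynomial (Fin m) ℝ) (k : ℕ) :
    MemLp (fun x => MvPolynomial.eval x P) (2 ^ (k + 1) : ℕ) (stdGaussianPi m) := by
  have hmeas := (integrable_eval_stdGaussianPi P).aestronglyMeasurable
  rw [← integrable_norm_rpow_iff hmeas (by simp) (by simp)]
  refine (integrable_eval_stdGaussianPi (P ^ 2 ^ (k + 1))).congr (.of_forall fun x => ?_)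
  simp only [map_pow, Real.norm_eq_abs, ENNReal.toReal_natCast, Real.rpow_natCast]
  exact (Even.pow_abs (Even.pow_of_ne_zero even_two (by omega)) _).symm

end Gaussian

/-- Nelson's estimate (equivalence of moments) for Gaussian polynomial chaos: for every
`n ≥ 1` and `p ∈ [2,∞)` there is a constant `C` (independent of the dimension `m`) such
that every polynomial `Q` of total degree at most `n` satisfies
`‖Q‖_{L^p(γ_m)} ≤ C ‖Q‖_{L²(γ_m)}`. -/
theorem nelson_estimate_polynomial (n : ℕ) (hn : 1 ≤ n) (p : ℝ) (hp : 2 ≤ p) :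
    ∃ C : ℝ, ∀ m : ℕ, 1 ≤ m → ∀ Q : MvPolynomial (Fin m) ℝ, Q.totalDegree ≤ n →
      (∫ x, |MvPolynomial.eval x Q| ^ p ∂(stdGaussianPi m)) ^ (1 / p)
        ≤ C * (∫ x, (MvPolynomial.eval x Q) ^ 2 ∂(stdGaussianPi m)) ^ ((1 : ℝ) / 2) := by
  obtain ⟨k, hk⟩ := pow_unbounded_of_one_lt p one_lt_two
  obtain ⟨K, hK, h⟩ := MvPolynomial.exists_moment_le k n
  refine ⟨K ^ ((1 : ℝ) / 2), fun m _ Q hQ => ?_⟩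
  set N : ℕ := 2 ^ (k + 1) with hN
  set S := ∫ x, (MvPolynomial.eval x Q) ^ 2 ∂(stdGaussianPi m) with hS
  have hS0 : 0 ≤ S := integral_nonneg fun x => sq_nonneg _
  have hmom := h m _ isGaussianFunctional_gaussianExpectation Q hQ
  simp only [gaussianExpectation_apply, map_pow, ← hS] at hmom
  have hNp : p ≤ N := by
    rw [hN]; push_cast
    exact hk.le.trans (pow_le_pow_right₀ one_le_two (Nat.le_succ k))
  have hLN := memLp_eval_stdGaussianPi Q k
  have hpN : ENNReal.ofReal p ≤ (N : ENNReal) := by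
    rw [← ENNReal.ofReal_natCast]; exact ENNReal.ofReal_le_ofReal hNp
  have hp0 : ENNReal.ofReal p ≠ 0 := by simp; linarith
  have hN0 : (N : ENNReal) ≠ 0 := by simp [hN]
  have hnorm := eLpNorm_le_eLpNorm_of_exponent_le hpN hLN.aestronglyMeasurable
  rw [(hLN.mono_exponent hpN).eLpNorm_eq_integral_rpow_norm hp0 (by simp),
    hLN.eLpNorm_eq_integral_rpow_norm hN0 (by simp),
    ENNReal.ofReal_le_ofReal_iff (by positivity), ENNReal.toReal_ofReal (by linarith)] at hnorm
  simp only [Real.norm_eq_abs, ENNReal.toReal_natCast, Real.rpow_natCast] at hnorm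
  rw [one_div p]
  refine hnorm.trans ?_
  have heven : Even N := Even.pow_of_ne_zero even_two (by omega)
  simp only [heven.pow_abs]
  calc (∫ x, MvPolynomial.eval x Q ^ N ∂stdGaussianPi m) ^ (N : ℝ)⁻¹
      ≤ ((K * S) ^ 2 ^ k) ^ (N : ℝ)⁻¹ :=
        Real.rpow_le_rpow (integral_nonneg fun x => heven.pow_nonneg _) hmom (by positivity)
    _ = (K * S) ^ ((1 : ℝ) / 2) := by
        rw [← Real.rpow_natCast, ← Real.rpow_mul (by positivity), hN]
        congr 1
        push_cast
        rw [pow_succ]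
        field_simp
    _ = K ^ ((1 : ℝ) / 2) * S ^ ((1 : ℝ) / 2) := Real.mul_rpow hK hS0
end

section
/- Let m ≥ 1 and let γ_m denote the standard Gaussian measure on ℝ^m. For every continuously differentiable compactly supported function f : ℝ^m → ℝ that is not identically zero, ∫_{ℝ^m} f² log|f| dγ_m ≤ ∫_{ℝ^m} |∇f|² dγ_m + (1/2) ( ∫_{ℝ^m} f² dγ_m ) log ( ∫_{ℝ^m} f² dγ_m ), with the convention that f(x)² log|f(x)| = 0 where f(x) = 0. -/
open MeasureTheory ProbabilityTheory
open scoped BigOperators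

open Set Filter Topology

theorem exists_primitive_of_density (p : ℝ → ℝ) (hc : Continuous p) (h_int : Integrable p)
    (h1 : ∫ x, p x = 1) :
    ∃ F : ℝ → ℝ, (∀ x, HasStrictDerivAt F (p x) x) ∧ Tendsto F atBot (𝓝 0) ∧
      Tendsto F atTop (𝓝 1) := by
  have key : ∀ x, (∫ y in Iic x, p y) = (∫ y in Iic 0, p y) + ∫ y in (0 : ℝ)..x, p y := by
    intro x
    rw [← intervalIntegral.integral_Iic_sub_Iic h_int.integrableOn h_int.integrableOn]
    ring
  refine ⟨fun x => ∫ y in Iic x, p y, fun x => ?_, ?_, ?_⟩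
  · rw [funext key]
    exact (intervalIntegral.integral_hasStrictDerivAt_right (hc.intervalIntegrable _ _)
      (hc.stronglyMeasurableAtFilter _ _) hc.continuousAt).const_add _
  · exact tendsto_integral_Iic_zero tendsto_id
  · have := (aecover_Iic (μ := (volume : Measure ℝ)) tendsto_id
      ).integral_tendsto_of_countably_generated h_int
    rwa [h1] at this

theorem gaussianPDFReal_std (x : ℝ) :
    gaussianPDFReal 0 1 x = (√(2 * Real.pi))⁻¹ * Real.exp (-x ^ 2 / 2) := by
  simp [gaussianPDFReal]

theorem continuous_gaussianPDFReal_std : Continuous (gaussianPDFReal 0 1) := by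
  rw [funext gaussianPDFReal_std]
  fun_prop

theorem hasDerivAt_gaussianPDFReal_std (x : ℝ) :
    HasDerivAt (gaussianPDFReal 0 1) (-x * gaussianPDFReal 0 1 x) x := by
  rw [funext gaussianPDFReal_std]
  have h : HasDerivAt (fun x : ℝ => -x ^ 2 / 2) (-x) x := by
    have := ((hasDerivAt_pow 2 x).neg).div_const 2
    exact this.congr_deriv (by ring)
  exact (h.exp.const_mul (√(2 * Real.pi))⁻¹).congr_deriv (by ring)

theorem tendsto_gaussianPDFReal_std_atTop :
    Tendsto (gaussianPDFReal 0 1) atTop (𝓝 0) := by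
  rw [funext gaussianPDFReal_std, ← mul_zero (√(2 * Real.pi))⁻¹]
  refine Tendsto.const_mul _ (Real.tendsto_exp_atBot.comp ?_)
  simp_rw [neg_div]
  exact tendsto_neg_atTop_atBot.comp ((tendsto_pow_atTop two_ne_zero).atTop_div_const two_pos)

theorem gaussianPDFReal_std_sub_one (x : ℝ) :
    gaussianPDFReal 0 1 (x - 1) = Real.exp (x - 1 / 2) * gaussianPDFReal 0 1 x := by
  rw [gaussianPDFReal_std, gaussianPDFReal_std, mul_left_comm, ← Real.exp_add]
  congr 2
  ring

theorem gaussianPDFReal_std_add_one (x : ℝ) :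
    gaussianPDFReal 0 1 (x + 1) = Real.exp (-x - 1 / 2) * gaussianPDFReal 0 1 x := by
  rw [gaussianPDFReal_std, gaussianPDFReal_std, mul_left_comm, ← Real.exp_add]
  congr 2
  ring

theorem integrable_gaussianReal_of_bounded {h : ℝ → ℝ} (hc : Continuous h) {C : ℝ}
    (hb : ∀ x, |h x| ≤ C) : Integrable (fun x => h x * gaussianPDFReal 0 1 x) :=
  (integrable_gaussianPDFReal 0 1).bdd_mul hc.aestronglyMeasurable
    (Eventually.of_forall hb)

/-- The increasing rearrangement transporting the density `h` with respect to the standard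
Gaussian measure to the standard Gaussian measure. -/
theorem exists_gaussian_transport {h : ℝ → ℝ} (hc : Continuous h) {ε M : ℝ} (hε : 0 < ε)
    (hlow : ∀ x, ε ≤ h x) (hup : ∀ x, h x ≤ M) (h1 : ∫ x, h x ∂(gaussianReal 0 1) = 1) :
    ∃ T : ℝ → ℝ,
      (∀ x, HasDerivAt T (h x * gaussianPDFReal 0 1 x / gaussianPDFReal 0 1 (T x)) x) ∧
      (∀ᶠ x in atTop, T x ≤ x + 1) ∧ (∀ᶠ x in atBot, x - 1 ≤ T x) := by
  have hpos : ∀ x, 0 < gaussianPDFReal 0 1 x := fun x => gaussianPDFReal_pos 0 1 x one_ne_zero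
  have hh : ∀ x, 0 < h x := fun x => hε.trans_le (hlow x)
  obtain ⟨Φ, hΦ, hΦ0, hΦ1⟩ := exists_primitive_of_density _ continuous_gaussianPDFReal_std
    (integrable_gaussianPDFReal 0 1) (integral_gaussianPDFReal_eq_one 0 one_ne_zero)
  obtain ⟨G, hG, hG0, hG1⟩ := exists_primitive_of_density (fun x => h x * gaussianPDFReal 0 1 x)
    (hc.mul continuous_gaussianPDFReal_std)
    (integrable_gaussianReal_of_bounded hc (C := M) fun x => by
      rw [abs_of_pos (hh x)]; exact hup x)
    (by rw [← h1, integral_gaussianReal_eq_integral_smul one_ne_zero]; simp [mul_comm])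
  have mΦ : StrictMono Φ := strictMono_of_deriv_pos fun x => by
    rw [(hΦ x).hasDerivAt.deriv]; exact hpos x
  have mG : StrictMono G := strictMono_of_deriv_pos fun x => by
    rw [(hG x).hasDerivAt.deriv]; exact mul_pos (hh x) (hpos x)
  have cΦ : Continuous Φ := continuous_iff_continuousAt.2 fun x => (hΦ x).hasDerivAt.continuousAt
  have hex : ∀ x, ∃ t, Φ t = G x := by
    intro x
    have h0 : 0 < G x := (mG.monotone.le_of_tendsto hG0 (x - 1)).trans_lt (mG (by linarith))
    have h2 : G x < 1 := (mG (by linarith : x < x + 1)).trans_le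
      (mG.monotone.ge_of_tendsto hG1 (x + 1))
    obtain ⟨a, ha⟩ := (hΦ0.eventually_lt_const h0).exists
    obtain ⟨b, hb⟩ := (hΦ1.eventually_const_lt h2).exists
    exact mem_range_of_exists_le_of_exists_ge cΦ ⟨a, ha.le⟩ ⟨b, hb.le⟩
  choose T hT using hex
  have hTinv : T = Function.invFun Φ ∘ G := by
    ext x
    rw [Function.comp_apply, ← hT x, Function.leftInverse_invFun mΦ.injective]
  refine ⟨T, fun x => ?_, ?_, ?_⟩
  · have e1 := ((hΦ (T x)).to_local_left_inverse (hpos (T x)).ne' (g := Function.invFun Φ)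
      (Eventually.of_forall (Function.leftInverse_invFun mΦ.injective))).hasDerivAt
    rw [hT x] at e1
    have e2 := e1.comp x (hG x).hasDerivAt
    rw [← hTinv] at e2
    exact e2.congr_deriv (div_eq_inv_mul _ _).symm
  · obtain ⟨x₀, hx₀⟩ : ∃ x₀, ∀ x ≥ x₀, Real.exp (-x - 1 / 2) ≤ ε := by
      refine eventually_atTop.1 ?_
      have : Tendsto (fun x : ℝ => Real.exp (-x - 1 / 2)) atTop (𝓝 0) :=
        Real.tendsto_exp_atBot.comp
          (tendsto_atBot_add_const_right _ _ tendsto_neg_atTop_atBot)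
      exact (this.eventually_lt_const hε).mono fun _ => le_of_lt
    have hd : ∀ x, HasDerivAt (fun x => Φ (x + 1) - G x)
        (gaussianPDFReal 0 1 (x + 1) - h x * gaussianPDFReal 0 1 x) x := fun x =>
      ((hΦ (x + 1)).hasDerivAt.comp_add_const x 1).sub (hG x).hasDerivAt
    have anti : AntitoneOn (fun x => Φ (x + 1) - G x) (Ici x₀) := by
      refine antitoneOn_of_deriv_nonpos (convex_Ici _)
        (fun x _ => (hd x).continuousAt.continuousWithinAt)
        (fun x _ => (hd x).differentiableAt.differentiableWithinAt) fun x hx => ?_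
      rw [interior_Ici] at hx
      rw [(hd x).deriv, gaussianPDFReal_std_add_one, ← sub_mul]
      exact mul_nonpos_of_nonpos_of_nonneg
        (sub_nonpos.2 ((hx₀ x (le_of_lt hx)).trans (hlow x))) (hpos x).le
    have lim : Tendsto (fun x => Φ (x + 1) - G x) atTop (𝓝 0) := by
      simpa using (hΦ1.comp (tendsto_atTop_add_const_right _ 1 tendsto_id)).sub hG1
    filter_upwards [eventually_ge_atTop x₀] with x hx
    have : 0 ≤ Φ (x + 1) - G x := le_of_tendsto lim <| by
      filter_upwards [eventually_ge_atTop x] with y hy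
      exact anti hx (le_trans hx hy) hy
    rw [← mΦ.le_iff_le, hT]
    linarith
  · obtain ⟨x₀, hx₀⟩ : ∃ x₀, ∀ x ≤ x₀, Real.exp (x - 1 / 2) ≤ ε := by
      refine eventually_atBot.1 ?_
      have : Tendsto (fun x : ℝ => Real.exp (x - 1 / 2)) atBot (𝓝 0) :=
        Real.tendsto_exp_atBot.comp
          (tendsto_atBot_add_const_right _ _ tendsto_id)
      exact (this.eventually_lt_const hε).mono fun _ => le_of_lt
    have hd : ∀ x, HasDerivAt (fun x => G x - Φ (x - 1))
        (h x * gaussianPDFReal 0 1 x - gaussianPDFReal 0 1 (x - 1)) x := fun x =>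
      (hG x).hasDerivAt.sub ((hΦ (x - 1)).hasDerivAt.comp_sub_const x 1)
    have mono : MonotoneOn (fun x => G x - Φ (x - 1)) (Iic x₀) := by
      refine monotoneOn_of_deriv_nonneg (convex_Iic _)
        (fun x _ => (hd x).continuousAt.continuousWithinAt)
        (fun x _ => (hd x).differentiableAt.differentiableWithinAt) fun x hx => ?_
      rw [interior_Iic] at hx
      rw [(hd x).deriv, gaussianPDFReal_std_sub_one, ← sub_mul]
      exact mul_nonneg
        (sub_nonneg.2 ((hx₀ x (le_of_lt hx)).trans (hlow x))) (hpos x).le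
    have lim : Tendsto (fun x => G x - Φ (x - 1)) atBot (𝓝 0) := by
      simpa [← sub_eq_add_neg] using hG0.sub (hΦ0.comp (tendsto_atBot_add_const_right _ (-1) tendsto_id))
    filter_upwards [eventually_le_atBot x₀] with x hx
    have : 0 ≤ G x - Φ (x - 1) := le_of_tendsto lim <| by
      filter_upwards [eventually_le_atBot x] with y hy
      exact mono (le_trans hy hx) hx hy
    rw [← mΦ.le_iff_le, hT]
    linarith

/-- Gaussian logarithmic Sobolev inequality on the line, for a probability density. -/
theorem integral_mul_log_le_of_integral_eq_one {h h' : ℝ → ℝ}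
    (hd : ∀ x, HasDerivAt h (h' x) x) (hc' : Continuous h') {ε M L : ℝ} (hε : 0 < ε)
    (hlow : ∀ x, ε ≤ h x) (hup : ∀ x, h x ≤ M) (hL : ∀ x, |h' x| ≤ L)
    (h1 : ∫ x, h x ∂(gaussianReal 0 1) = 1) :
    ∫ x, (h x * Real.log (h x) - 1 / 2 * (h' x ^ 2 / h x)) ∂(gaussianReal 0 1) ≤ 0 := by
  have hc : Continuous h := continuous_iff_continuousAt.2 fun x => (hd x).continuousAt
  have hh : ∀ x, 0 < h x := fun x => hε.trans_le (hlow x)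
  have hpos : ∀ x, 0 < gaussianPDFReal 0 1 x := fun x => gaussianPDFReal_pos 0 1 x one_ne_zero
  obtain ⟨T, hT, hTtop, hTbot⟩ := exists_gaussian_transport hc hε hlow hup h1
  set φ := gaussianPDFReal 0 1 with hφ
  set k : ℝ → ℝ := fun x => h x * Real.log (h x) - 1 / 2 * (h' x ^ 2 / h x) with hk
  have hkc : Continuous k :=
    (hc.mul (hc.log fun x => (hh x).ne')).sub
      (continuous_const.mul ((hc'.pow 2).div hc fun x => (hh x).ne'))
  have hkb : ∃ C, ∀ x, |k x| ≤ C := by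
    obtain ⟨C, hC⟩ := (isCompact_Icc (a := ε) (b := M)).exists_bound_of_continuousOn
      Real.continuous_mul_log.continuousOn
    refine ⟨C + 1 / 2 * (L ^ 2 / ε), fun x =>
      (abs_sub _ _).trans (add_le_add (hC _ ⟨hlow x, hup x⟩) ?_)⟩
    rw [abs_of_nonneg (by have := hh x; positivity)]
    have : h' x ^ 2 ≤ L ^ 2 := sq_le_sq' (abs_le.1 (hL x)).1 (abs_le.1 (hL x)).2
    have := hlow x
    gcongr
  obtain ⟨C, hC⟩ := hkb
  have h_int : Integrable (fun x => k x * φ x) := integrable_gaussianReal_of_bounded hkc hC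
  rw [integral_gaussianReal_eq_integral_smul one_ne_zero]
  rw [show (fun x => gaussianPDFReal 0 1 x • (h x * Real.log (h x) - 1 / 2 * (h' x ^ 2 / h x))) =
    fun x => k x * φ x from funext fun x => mul_comm _ _]
  have hW : ∀ x, HasDerivAt (fun x => h x * (T x - x) * φ x)
      ((h' x * (T x - x) + h x * (h x * φ x / φ (T x) - 1)) * φ x +
        h x * (T x - x) * (-x * φ x)) x := fun x =>
    ((hd x).mul ((hT x).sub (hasDerivAt_id x))).mul (hasDerivAt_gaussianPDFReal_std x)
  have hptw : ∀ x, k x * φ x ≤ (h' x * (T x - x) + h x * (h x * φ x / φ (T x) - 1)) * φ x +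
        h x * (T x - x) * (-x * φ x) := by
    intro x
    have e1 : φ x / φ (T x) = Real.exp (T x ^ 2 / 2 - x ^ 2 / 2) := by
      have : (√(2 * Real.pi))⁻¹ ≠ 0 := by positivity
      rw [hφ, gaussianPDFReal_std, gaussianPDFReal_std, mul_div_mul_left _ _ this, ← Real.exp_sub]
      congr 1
      ring
    have e2 : Real.log (h x * φ x / φ (T x)) = Real.log (h x) + (T x ^ 2 / 2 - x ^ 2 / 2) := by
      rw [mul_div_assoc, Real.log_mul (hh x).ne' (div_pos (hpos _) (hpos _)).ne', e1, Real.log_exp]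
    have e3 := Real.log_le_sub_one_of_pos (div_pos (mul_pos (hh x) (hpos x)) (hpos (T x)))
    rw [e2] at e3
    have e4 : h x * Real.log (h x) ≤
        h x * ((h x * φ x / φ (T x) - 1) - (T x ^ 2 / 2 - x ^ 2 / 2)) :=
      mul_le_mul_of_nonneg_left (by linarith) (hh x).le
    have e5 : 0 ≤ 1 / 2 * ((h' x + h x * (T x - x)) ^ 2 / h x) := by
      have := hh x
      positivity
    have e6 : (h' x + h x * (T x - x)) ^ 2 / h x =
        h' x ^ 2 / h x + 2 * h' x * (T x - x) + h x * (T x - x) ^ 2 := by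
      have := (hh x).ne'
      field_simp
      ring
    have e7 : k x ≤ h' x * (T x - x) + h x * (h x * φ x / φ (T x) - 1)
        + h x * (T x - x) * (-x) := by
      rw [e6] at e5
      simp only [hk]
      linear_combination e4 + e5
    calc k x * φ x ≤ _ := mul_le_mul_of_nonneg_right e7 (hpos x).le
      _ = _ := by ring
  have hlim := intervalIntegral_tendsto_integral h_int tendsto_neg_atTop_atBot tendsto_id
  have hlim2 : Tendsto (fun R : ℝ => 2 * M * φ R) atTop (𝓝 0) := by
    simpa using tendsto_gaussianPDFReal_std_atTop.const_mul (2 * M)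
  refine le_of_tendsto_of_tendsto hlim hlim2 ?_
  filter_upwards [hTtop, tendsto_neg_atTop_atBot.eventually hTbot, eventually_ge_atTop 0]
    with R hR1 hR2 hR0
  have hsym : φ (-R) = φ R := by simp [hφ, gaussianPDFReal_std]
  have := intervalIntegral.integral_le_sub_of_hasDeriv_right_of_le (a := -R) (b := R)
    (by linarith) (fun x _ => (hW x).continuousAt.continuousWithinAt)
    (fun x _ => (hW x).hasDerivWithinAt) h_int.integrableOn (fun x _ => hptw x)
  refine this.trans ?_
  simp only [hsym]
  have b1 : h R * (T R - R) ≤ M := by nlinarith [hh R, hup R]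
  have b2 : -(h (-R) * (T (-R) - -R)) ≤ M := by nlinarith [hh (-R), hup (-R)]
  nlinarith [hpos R]

/-- The entropy functional `Ent_μ(g) = ∫ g log g dμ - (∫ g dμ) log (∫ g dμ)`. -/
noncomputable def entropyFunctional {X : Type*} [MeasurableSpace X] (μ : Measure X)
    (g : X → ℝ) : ℝ :=
  ∫ x, g x * Real.log (g x) ∂μ - (∫ x, g x ∂μ) * Real.log (∫ x, g x ∂μ)

theorem integral_mem_Icc_of_forall {X : Type*} [MeasurableSpace X] (μ : Measure X)
    [IsProbabilityMeasure μ] {g : X → ℝ} (hg : StronglyMeasurable g) {ε M : ℝ}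
    (hlow : ∀ x, ε ≤ g x) (hup : ∀ x, g x ≤ M) : ε ≤ ∫ x, g x ∂μ ∧ ∫ x, g x ∂μ ≤ M := by
  have h_int : Integrable g μ := .of_bound hg.aestronglyMeasurable (max |ε| |M|)
    (Eventually.of_forall fun x => abs_le_max_abs_abs (hlow x) (hup x))
  constructor
  · simpa using integral_mono (integrable_const ε) h_int hlow
  · simpa using integral_mono h_int (integrable_const M) hup

/-- Subadditivity of the entropy functional for a product of two probability measures. -/
theorem entropyFunctional_prod_le {X Y : Type*} [MeasurableSpace X] [MeasurableSpace Y]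
    (μ : Measure X) (ν : Measure Y) [IsProbabilityMeasure μ] [IsProbabilityMeasure ν]
    {k : X × Y → ℝ} (hk : StronglyMeasurable k) {ε M : ℝ} (hε : 0 < ε)
    (hlow : ∀ z, ε ≤ k z) (hup : ∀ z, k z ≤ M) :
    Integrable (fun y => entropyFunctional μ (fun x => k (x, y))) ν ∧
    Integrable (fun x => entropyFunctional ν (fun y => k (x, y))) μ ∧
    entropyFunctional (μ.prod ν) k ≤
      ∫ y, entropyFunctional μ (fun x => k (x, y)) ∂ν +
        ∫ x, entropyFunctional ν (fun y => k (x, y)) ∂μ := by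
  set G : Y → ℝ := fun y => ∫ x, k (x, y) ∂μ with hG
  set H : X → ℝ := fun x => ∫ y, k (x, y) ∂ν with hH
  set Z : ℝ := ∫ z, k z ∂(μ.prod ν) with hZ
  have mG : StronglyMeasurable G := hk.integral_prod_left'
  have mH : StronglyMeasurable H := hk.integral_prod_right'
  have bG : ∀ y, ε ≤ G y ∧ G y ≤ M := fun y => integral_mem_Icc_of_forall μ
    (hk.comp_measurable measurable_prodMk_right) (fun x => hlow _) (fun x => hup _)
  have bH : ∀ x, ε ≤ H x ∧ H x ≤ M := fun x => integral_mem_Icc_of_forall ν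
    (hk.comp_measurable measurable_prodMk_left) (fun x => hlow _) (fun x => hup _)
  have bZ : ε ≤ Z ∧ Z ≤ M := integral_mem_Icc_of_forall _ hk hlow hup
  have bd : ∀ {t}, ε ≤ t → t ≤ M → ‖t‖ ≤ M := fun h1 h2 => by
    rw [Real.norm_of_nonneg (hε.le.trans h1)]; exact h2
  obtain ⟨K, hK⟩ := (isCompact_Icc (a := ε) (b := M)).exists_bound_of_continuousOn
    (f := Real.log) (Real.continuousOn_log.mono fun t ht => (hε.trans_le ht.1).ne')
  have ik : Integrable k (μ.prod ν) := .of_bound hk.aestronglyMeasurable M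
    (Eventually.of_forall fun z => bd (hlow z) (hup z))
  have iklogk : Integrable (fun z => k z * Real.log (k z)) (μ.prod ν) :=
    ik.mul_bdd hk.measurable.log.aestronglyMeasurable (Eventually.of_forall fun z => hK _ ⟨hlow z, hup z⟩)
  have iklogG : Integrable (fun z : X × Y => k z * Real.log (G z.2)) (μ.prod ν) :=
    ik.mul_bdd (mG.measurable.comp measurable_snd).log.aestronglyMeasurable
      (Eventually.of_forall fun z => hK _ (bG z.2))
  have iklogH : Integrable (fun z : X × Y => k z * Real.log (H z.1)) (μ.prod ν) :=
    ik.mul_bdd (mH.measurable.comp measurable_fst).log.aestronglyMeasurable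
      (Eventually.of_forall fun z => hK _ (bH z.1))
  have iG : Integrable G ν := .of_bound mG.aestronglyMeasurable M
    (Eventually.of_forall fun z => bd (bG z).1 (bG z).2)
  have iH : Integrable H μ := .of_bound mH.aestronglyMeasurable M
    (Eventually.of_forall fun z => bd (bH z).1 (bH z).2)
  have iGlogG : Integrable (fun y => G y * Real.log (G y)) ν :=
    iG.mul_bdd mG.measurable.log.aestronglyMeasurable (Eventually.of_forall fun z => hK _ (bG z))
  have iHlogH : Integrable (fun y => H y * Real.log (H y)) μ :=
    iH.mul_bdd mH.measurable.log.aestronglyMeasurable (Eventually.of_forall fun z => hK _ (bH z))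
  have iHG : Integrable (fun z : X × Y => H z.1 * G z.2) (μ.prod ν) := iH.mul_prod iG
  have e1 : ∫ z : X × Y, k z * Real.log (G z.2) ∂(μ.prod ν) = ∫ y, G y * Real.log (G y) ∂ν := by
    rw [integral_prod_symm _ iklogG]
    simp only [integral_mul_const, hG]
  have e2 : ∫ z : X × Y, k z * Real.log (H z.1) ∂(μ.prod ν) = ∫ x, H x * Real.log (H x) ∂μ := by
    rw [integral_prod _ iklogH]
    simp only [integral_mul_const, hH]
  have e3 : ∫ z : X × Y, H z.1 * G z.2 ∂(μ.prod ν) = Z * Z := by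
    rw [integral_prod_mul, hZ]
    congr 1
    · exact (integral_prod _ ik).symm
    · exact (integral_prod_symm _ ik).symm
  have hZ0 : 0 < Z := hε.trans_le bZ.1
  have hptw : ∀ z : X × Y, k z - H z.1 * G z.2 * Z⁻¹ ≤ k z * Real.log (k z) -
      k z * Real.log (G z.2) - k z * Real.log (H z.1) + k z * Real.log Z := by
    intro z
    have h1 := hε.trans_le (hlow z)
    have h2 := hε.trans_le (bG z.2).1
    have h3 := hε.trans_le (bH z.1).1
    have h4 := Real.log_le_sub_one_of_pos
      (div_pos (mul_pos (mul_pos h3 h2) (inv_pos.2 hZ0)) h1)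
    rw [Real.log_div (by positivity) (by positivity), Real.log_mul (by positivity) (by positivity),
      Real.log_mul (by positivity) (by positivity), Real.log_inv] at h4
    have h5 := mul_le_mul_of_nonneg_left h4 h1.le
    have h6 : k z * (H z.1 * G z.2 * Z⁻¹ / k z - 1) = H z.1 * G z.2 * Z⁻¹ - k z := by
      field_simp
    rw [h6] at h5
    linear_combination h5
  have i₁ : Integrable (fun z => k z * Real.log (k z) - k z * Real.log (G z.2)) (μ.prod ν) :=
    iklogk.sub iklogG
  have i₂ : Integrable (fun z => k z * Real.log (k z) - k z * Real.log (G z.2) -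
      k z * Real.log (H z.1)) (μ.prod ν) := i₁.sub iklogH
  have h_int := integral_mono (ik.sub (iHG.mul_const Z⁻¹))
    (i₂.add (ik.mul_const (Real.log Z))) hptw
  simp only [Pi.sub_apply, Pi.add_apply] at h_int
  rw [integral_sub ik (iHG.mul_const Z⁻¹), integral_mul_const, e3,
    integral_add i₂ (ik.mul_const (Real.log Z)),
    integral_sub i₁ iklogH, integral_sub iklogk iklogG, e1, e2,
    integral_mul_const, ← hZ, mul_inv_cancel_right₀ hZ0.ne', sub_self] at h_int
  have f1 : ∫ y, entropyFunctional μ (fun x => k (x, y)) ∂ν =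
      ∫ z, k z * Real.log (k z) ∂(μ.prod ν) - ∫ y, G y * Real.log (G y) ∂ν := by
    rw [integral_prod_symm _ iklogk]
    exact integral_sub iklogk.integral_prod_right iGlogG
  have f2 : ∫ x, entropyFunctional ν (fun y => k (x, y)) ∂μ =
      ∫ z, k z * Real.log (k z) ∂(μ.prod ν) - ∫ y, H y * Real.log (H y) ∂μ := by
    rw [integral_prod _ iklogk]
    exact integral_sub iklogk.integral_prod_left iHlogH
  refine ⟨iklogk.integral_prod_right.sub iGlogG, iklogk.integral_prod_left.sub iHlogH, ?_⟩
  rw [f1, f2, entropyFunctional, ← hZ]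
  linarith

/-- Gaussian logarithmic Sobolev inequality on the line. -/
theorem entropyFunctional_gaussianReal_le {g g' : ℝ → ℝ}
    (hd : ∀ x, HasDerivAt g (g' x) x) (hc' : Continuous g') {ε M L : ℝ} (hε : 0 < ε)
    (hlow : ∀ x, ε ≤ g x) (hup : ∀ x, g x ≤ M) (hL : ∀ x, |g' x| ≤ L) :
    entropyFunctional (gaussianReal 0 1) g ≤
      1 / 2 * ∫ x, g' x ^ 2 / g x ∂(gaussianReal 0 1) := by
  have hc : Continuous g := continuous_iff_continuousAt.2 fun x => (hd x).continuousAt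
  have hg : ∀ x, 0 < g x := fun x => hε.trans_le (hlow x)
  set Z : ℝ := ∫ x, g x ∂(gaussianReal 0 1) with hZ
  have hZ0 : 0 < Z := hε.trans_le
    (integral_mem_Icc_of_forall (gaussianReal 0 1) hc.stronglyMeasurable hlow hup).1
  have key := integral_mul_log_le_of_integral_eq_one (h := fun x => g x / Z)
    (h' := fun x => g' x / Z) (fun x => (hd x).div_const Z) (hc'.div_const Z)
    (ε := ε / Z) (M := M / Z) (L := L / Z) (div_pos hε hZ0)
    (fun x => by have := hlow x; gcongr) (fun x => by have := hup x; gcongr)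
    (fun x => by rw [abs_div, abs_of_pos hZ0]; have := hL x; gcongr)
    (by rw [integral_div, ← hZ, div_self hZ0.ne'])
  have e : ∀ x, g x / Z * Real.log (g x / Z) - 1 / 2 * ((g' x / Z) ^ 2 / (g x / Z)) =
      Z⁻¹ * (g x * Real.log (g x) - g x * Real.log Z - 1 / 2 * (g' x ^ 2 / g x)) := by
    intro x
    have := hg x
    rw [Real.log_div this.ne' hZ0.ne']
    field_simp
  simp_rw [e] at key
  have ig : Integrable g (gaussianReal 0 1) := .of_bound hc.aestronglyMeasurable M
    (Eventually.of_forall fun x => by rw [Real.norm_of_nonneg (hg x).le]; exact hup x)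
  obtain ⟨C, hC⟩ := (isCompact_Icc (a := ε) (b := M)).exists_bound_of_continuousOn
      Real.continuous_mul_log.continuousOn
  have iglog : Integrable (fun x => g x * Real.log (g x)) (gaussianReal 0 1) :=
    .of_bound (hc.mul (hc.log fun x => (hg x).ne')).aestronglyMeasurable C
      (Eventually.of_forall fun x => hC _ ⟨hlow x, hup x⟩)
  have iI : Integrable (fun x => g' x ^ 2 / g x) (gaussianReal 0 1) :=
    .of_bound ((hc'.pow 2).div hc fun x => (hg x).ne').aestronglyMeasurable (L ^ 2 / ε)
      (Eventually.of_forall fun x => by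
        have h1 := hg x
        have h2 := hlow x
        rw [Real.norm_of_nonneg (by positivity)]
        have : g' x ^ 2 ≤ L ^ 2 := sq_le_sq' (abs_le.1 (hL x)).1 (abs_le.1 (hL x)).2
        gcongr)
  have i₁ : Integrable (fun x => g x * Real.log (g x) - g x * Real.log Z) (gaussianReal 0 1) :=
    iglog.sub (ig.mul_const _)
  rw [integral_const_mul, integral_sub i₁ (iI.const_mul _),
    integral_sub iglog (ig.mul_const _), integral_mul_const, integral_const_mul, ← hZ] at key
  have := nonpos_of_mul_nonpos_right key (inv_pos.2 hZ0)
  rw [entropyFunctional, ← hZ]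
  linarith

instance (m : ℕ) : IsProbabilityMeasure (stdGaussianPi m) := by
  unfold stdGaussianPi
  infer_instance

theorem measurePreserving_piFinSuccAbove_stdGaussianPi (m : ℕ) :
    MeasurePreserving (MeasurableEquiv.piFinSuccAbove (fun _ : Fin (m + 1) => ℝ) 0)
      (stdGaussianPi (m + 1)) ((gaussianReal 0 1).prod (stdGaussianPi m)) :=
  measurePreserving_piFinSuccAbove (fun _ : Fin (m + 1) => gaussianReal 0 1) 0

theorem integral_stdGaussianPi_succ (m : ℕ) (F : (Fin (m + 1) → ℝ) → ℝ) :
    ∫ x, F x ∂(stdGaussianPi (m + 1)) =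
      ∫ z, F (Fin.cons z.1 z.2) ∂((gaussianReal 0 1).prod (stdGaussianPi m)) := by
  rw [← (measurePreserving_piFinSuccAbove_stdGaussianPi m).symm.integral_comp' F]
  refine integral_congr_ae (Eventually.of_forall fun z => ?_)
  change F (Fin.insertNth 0 z.1 z.2) = _
  rw [Fin.insertNth_zero']

/-- Gaussian logarithmic Sobolev inequality for bounded functions bounded away from zero, with
bounded continuous partial derivatives. -/
theorem entropyFunctional_stdGaussianPi_le (m : ℕ) {g : (Fin m → ℝ) → ℝ}
    {D : Fin m → (Fin m → ℝ) → ℝ} (hc : Continuous g) (hD : ∀ i, Continuous (D i))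
    (hd : ∀ x i, HasDerivAt (fun t => g (Function.update x i t)) (D i x) (x i))
    {ε M L : ℝ} (hε : 0 < ε) (hlow : ∀ x, ε ≤ g x) (hup : ∀ x, g x ≤ M)
    (hL : ∀ i x, |D i x| ≤ L) :
    entropyFunctional (stdGaussianPi m) g ≤
      1 / 2 * ∫ x, ∑ i, D i x ^ 2 / g x ∂(stdGaussianPi m) := by
  induction m with
  | zero =>
    have h : ∀ x, g x = g 0 := fun x => congrArg g (Subsingleton.elim _ _)
    simp [entropyFunctional, h]
  | succ m ih =>
    have cc : Continuous fun z : ℝ × (Fin m → ℝ) => (Fin.cons z.1 z.2 : Fin (m + 1) → ℝ) := by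
      fun_prop
    set k : ℝ × (Fin m → ℝ) → ℝ := fun z => g (Fin.cons z.1 z.2) with hk
    have ck : Continuous k := hc.comp cc
    have hk0 : ∀ z, 0 < k z := fun z => hε.trans_le (hlow _)
    have iD : ∀ i, Integrable (fun z : ℝ × (Fin m → ℝ) => D i (Fin.cons z.1 z.2) ^ 2 / k z)
        ((gaussianReal 0 1).prod (stdGaussianPi m)) := fun i =>
      .of_bound ((((hD i).comp cc).pow 2).div ck fun z => (hk0 z).ne').aestronglyMeasurable
        (L ^ 2 / ε) (Eventually.of_forall fun z => by
          have h1 := hk0 z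
          have h2 : ε ≤ k z := hlow _
          have h3 := abs_le.1 (hL i (Fin.cons z.1 z.2))
          rw [Real.norm_of_nonneg (by positivity)]
          have := sq_le_sq' h3.1 h3.2
          gcongr)
    have iS : Integrable (fun z : ℝ × (Fin m → ℝ) =>
        ∑ i : Fin m, D i.succ (Fin.cons z.1 z.2) ^ 2 / k z)
        ((gaussianReal 0 1).prod (stdGaussianPi m)) := integrable_finsetSum _ fun i _ => iD i.succ
    obtain ⟨i1, i2, hsub⟩ := entropyFunctional_prod_le (gaussianReal 0 1) (stdGaussianPi m)
      ck.stronglyMeasurable hε (fun z => hlow _) (fun z => hup _)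
    have hfst : ∀ y, entropyFunctional (gaussianReal 0 1) (fun x => k (x, y)) ≤
        1 / 2 * ∫ x, D 0 (Fin.cons x y) ^ 2 / k (x, y) ∂(gaussianReal 0 1) := fun y =>
      entropyFunctional_gaussianReal_le (fun x => by
          simpa [Fin.update_cons_zero, hk] using hd (Fin.cons x y) 0)
        ((hD 0).comp (cc.comp (by fun_prop : Continuous fun x : ℝ => (x, y))))
        hε (fun x => hlow _) (fun x => hup _) (fun x => hL _ _)
    have hsnd : ∀ x, entropyFunctional (stdGaussianPi m) (fun y => k (x, y)) ≤
        1 / 2 * ∫ y, ∑ i : Fin m, D i.succ (Fin.cons x y) ^ 2 / k (x, y) ∂(stdGaussianPi m) :=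
      fun x => ih (D := fun i y => D i.succ (Fin.cons x y)) (ck.comp (by fun_prop))
        (fun i => (hD i.succ).comp
          (cc.comp (by fun_prop : Continuous fun y : Fin m → ℝ => (x, y))))
        (fun y i => by simpa [← Fin.cons_update, hk] using hd (Fin.cons x y) i.succ)
        (fun y => hlow _) (fun y => hup _) (fun i y => hL _ _)
    have h1 := integral_mono i1 ((iD 0).integral_prod_right.const_mul (1 / 2)) hfst
    have h2 := integral_mono i2 (iS.integral_prod_left.const_mul (1 / 2)) hsnd
    rw [integral_const_mul, ← integral_prod_symm _ (iD 0)] at h1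
    rw [integral_const_mul, ← integral_prod _ iS] at h2
    have hE : entropyFunctional (stdGaussianPi (m + 1)) g =
        entropyFunctional ((gaussianReal 0 1).prod (stdGaussianPi m)) k := by
      simp only [entropyFunctional, integral_stdGaussianPi_succ, hk]
    rw [hE, integral_stdGaussianPi_succ]
    simp_rw [Fin.sum_univ_succ]
    rw [integral_add (iD 0) iS]
    linarith

/-- The Gaussian logarithmic Sobolev inequality: for `f : ℝ^m → ℝ` continuously
differentiable, compactly supported and not identically zero,
`∫ f² log|f| dγ ≤ ∫ |∇f|² dγ + (1/2) (∫ f² dγ) log(∫ f² dγ)`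
(with the convention `f² log|f| = 0` where `f = 0`, automatic since `Real.log 0 = 0`). -/
theorem gaussian_log_sobolev (m : ℕ) (hm : 1 ≤ m)
    (f : (Fin m → ℝ) → ℝ) (hf : ContDiff ℝ 1 f) (hsupp : HasCompactSupport f)
    (hne : f ≠ 0) :
    ∫ x, (f x) ^ 2 * Real.log |f x| ∂(stdGaussianPi m)
      ≤ (∫ x, ∑ i, (fderiv ℝ f x (Pi.single i 1)) ^ 2 ∂(stdGaussianPi m))
        + (1 / 2) * (∫ x, (f x) ^ 2 ∂(stdGaussianPi m))
            * Real.log (∫ x, (f x) ^ 2 ∂(stdGaussianPi m)) := by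
  have hcf : Continuous f := hf.continuous
  obtain ⟨A, hA⟩ := hsupp.exists_bound_of_continuous hcf
  have hcd : ∀ i, Continuous fun x => fderiv ℝ f x (Pi.single i 1) := fun i =>
    (hf.continuous_fderiv one_ne_zero).clm_apply continuous_const
  obtain ⟨B, hB⟩ := (hsupp.fderiv ℝ).exists_bound_of_continuous
    (hf.continuous_fderiv one_ne_zero)
  have hBi : ∀ i x, |fderiv ℝ f x (Pi.single i 1)| ≤ B := fun i x =>
    ((fderiv ℝ f x).le_opNorm _).trans (by simpa [Pi.norm_single] using hB x)
  have hA2 : ∀ x, f x ^ 2 ≤ A ^ 2 := fun x => sq_le_sq' (abs_le.1 (hA x)).1 (abs_le.1 (hA x)).2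
  have if2 : Integrable (fun x => f x ^ 2) (stdGaussianPi m) :=
    .of_bound (hcf.pow 2).aestronglyMeasurable (A ^ 2) (Eventually.of_forall fun x => by
      rw [Real.norm_of_nonneg (sq_nonneg _)]; exact hA2 x)
  have idf : Integrable (fun x => ∑ i, fderiv ℝ f x (Pi.single i 1) ^ 2) (stdGaussianPi m) :=
    integrable_finsetSum _ fun i _ => .of_bound ((hcd i).pow 2).aestronglyMeasurable (B ^ 2)
      (Eventually.of_forall fun x => by
        rw [Real.norm_of_nonneg (sq_nonneg _)]
        exact sq_le_sq' (abs_le.1 (hBi i x)).1 (abs_le.1 (hBi i x)).2)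
  set Z : ℝ := ∫ x, f x ^ 2 ∂(stdGaussianPi m) with hZ
  set I : ℝ := ∫ x, ∑ i, fderiv ℝ f x (Pi.single i 1) ^ 2 ∂(stdGaussianPi m) with hI
  have hreg : ∀ ε : ℝ, 0 < ε →
      ∫ x, (f x ^ 2 + ε) * Real.log (f x ^ 2 + ε) ∂(stdGaussianPi m) ≤
        2 * I + (Z + ε) * Real.log (Z + ε) := by
    intro ε hε
    have hdi : ∀ x i, HasDerivAt (fun t => f (Function.update x i t) ^ 2 + ε)
        (2 * f x * fderiv ℝ f x (Pi.single i 1)) (x i) := fun x i => by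
      have h1 : HasFDerivAt f (fderiv ℝ f x) (Function.update x i (x i)) := by
        rw [Function.update_eq_self]
        exact (hf.differentiable one_ne_zero x).hasFDerivAt
      have h2 := ((h1.comp_hasDerivAt (x i) (hasDerivAt_update x i (x i))).pow 2).add_const ε
      exact h2.congr_deriv (by simp)
    have key := entropyFunctional_stdGaussianPi_le m (g := fun x => f x ^ 2 + ε)
      (D := fun i x => 2 * f x * fderiv ℝ f x (Pi.single i 1)) (by fun_prop)
      (fun i => (continuous_const.mul hcf).mul (hcd i)) hdi (M := A ^ 2 + ε)
      (L := 2 * A * B) hε (fun x => by nlinarith [sq_nonneg (f x)]) (fun x => by linarith [hA2 x])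
      (fun i x => by
        rw [abs_mul, abs_mul, abs_two]
        have h1 : |f x| ≤ A := hA x
        have h2 := hBi i x
        have h3 := (abs_nonneg _).trans h1
        gcongr)
    have hmono : ∫ x, ∑ i, (2 * f x * fderiv ℝ f x (Pi.single i 1)) ^ 2 / (f x ^ 2 + ε)
        ∂(stdGaussianPi m) ≤ 4 * I := by
      rw [hI, ← integral_const_mul]
      refine integral_mono_of_nonneg (Eventually.of_forall fun x => ?_) (idf.const_mul 4)
        (Eventually.of_forall fun x => ?_)
      · exact Finset.sum_nonneg fun i _ => by positivity
      · simp only [Finset.mul_sum]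
        refine Finset.sum_le_sum fun i _ => ?_
        rw [div_le_iff₀ (by positivity)]
        nlinarith [mul_nonneg (sq_nonneg (fderiv ℝ f x (Pi.single i 1))) hε.le]
    have hsum : ∫ x, (f x ^ 2 + ε) ∂(stdGaussianPi m) = Z + ε := by
      rw [integral_add if2 (integrable_const ε)]
      simp [hZ]
    rw [entropyFunctional, hsum] at key
    linarith
  obtain ⟨C, hC⟩ := (isCompact_Icc (a := 0) (b := A ^ 2 + 1)).exists_bound_of_continuousOn
    Real.continuous_mul_log.continuousOn
  have hlim1 : Tendsto (fun ε : ℝ => ∫ x, (f x ^ 2 + ε) * Real.log (f x ^ 2 + ε) ∂(stdGaussianPi m))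
      (𝓝[>] 0) (𝓝 (∫ x, f x ^ 2 * Real.log (f x ^ 2) ∂(stdGaussianPi m))) := by
    refine tendsto_integral_filter_of_dominated_convergence (fun _ => C)
      (Eventually.of_forall fun ε =>
        (Real.continuous_mul_log.comp (by fun_prop : Continuous fun x => f x ^ 2 + ε)
          ).aestronglyMeasurable) ?_ (integrable_const C) (Eventually.of_forall fun x => ?_)
    · filter_upwards [Ioo_mem_nhdsGT (zero_lt_one' ℝ)] with ε hε
      exact Eventually.of_forall fun x =>
        hC _ ⟨add_nonneg (sq_nonneg _) hε.1.le, add_le_add (hA2 x) hε.2.le⟩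
    · have : Continuous fun ε : ℝ => (f x ^ 2 + ε) * Real.log (f x ^ 2 + ε) :=
        Real.continuous_mul_log.comp (by fun_prop : Continuous fun ε : ℝ => f x ^ 2 + ε)
      simpa using (this.tendsto 0).mono_left nhdsWithin_le_nhds
  have hlim2 : Tendsto (fun ε : ℝ => 2 * I + (Z + ε) * Real.log (Z + ε)) (𝓝[>] 0)
      (𝓝 (2 * I + Z * Real.log Z)) := by
    have : Continuous fun ε : ℝ => 2 * I + (Z + ε) * Real.log (Z + ε) :=
      continuous_const.add
        (Real.continuous_mul_log.comp (by fun_prop : Continuous fun ε : ℝ => Z + ε))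
    simpa using (this.tendsto 0).mono_left nhdsWithin_le_nhds
  have hfin := le_of_tendsto_of_tendsto hlim1 hlim2
    (eventually_nhdsWithin_of_forall fun ε hε => hreg ε hε)
  have hlog : ∀ x, f x ^ 2 * Real.log (f x ^ 2) = 2 * (f x ^ 2 * Real.log |f x|) := fun x => by
    rw [Real.log_pow, Real.log_abs]
    push_cast
    ring
  simp_rw [hlog] at hfin
  rw [integral_const_mul] at hfin
  linarith
end
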